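/- arXiv:1710.06470 — 4 statements merged into one kernel-verified Lean document; each statement's English description precedes it below -/
import Mathlib

section
/- Let n ≥ 1 and let w : ℤ/(2n)ℤ → Λ be a cyclic sequence of length 2n over a type Λ in which every occurring letter occurs exactly twice, i.e., for every index i there are exactly two indices j with w(j) = w(i). Then w contains two step-disjoint simple closed factors: there exist indices i₁, i₂ ∈ ℤ/(2n)ℤ and natural numbers k₁, k₂ with 0 ≤ k₁, k₂ ≤ 2n − 2 such that, for each t ∈ {1,2}, w(i_t) = w(i_t + k_t + 1) and the letters w(i_t), w(i_t + 1), …, w(i_t + k_t) are pairwise distinct, and the two sets of steps {(i₁ + s, i₁ + s + 1) : 0 ≤ s ≤ k₁} and {(i₂ + s, i₂ + s + 1) : 0 ≤ s ≤ k₂} are disjoint. -/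
/-- A sequence taking the same value at `a < b` has a simple closed factor between `a` and `b`. -/
theorem exists_simple_closed_factor {Λ : Type*} (f : ℕ → Λ) {a b : ℕ} (hab : a < b)
    (h : f a = f b) :
    ∃ i k : ℕ, a ≤ i ∧ i + k + 1 ≤ b ∧ f i = f (i + k + 1) ∧
      ∀ s s' : ℕ, s ≤ k → s' ≤ k → f (i + s) = f (i + s') → s = s' := by
  induction hd : b - a using Nat.strong_induction_on generalizing a b with
  | _ d ih =>
    by_cases hinj : ∃ s s' : ℕ, s < s' ∧ a + s' < b ∧ f (a + s) = f (a + s')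
    · obtain ⟨s, s', hlt, hb, heq⟩ := hinj
      obtain ⟨i, k, hi, hk, hf, hsimple⟩ :=
        ih (a + s' - (a + s)) (by omega) (by omega) heq rfl
      exact ⟨i, k, by omega, by omega, hf, hsimple⟩
    · push Not at hinj
      refine ⟨a, b - a - 1, le_rfl, by omega, ?_, fun s s' hs hs' heq ↦ ?_⟩
      · rwa [show a + (b - a - 1) + 1 = b by omega]
      · rcases lt_trichotomy s s' with hlt | hlt | hlt
        · exact absurd heq (hinj s s' hlt (by omega))
        · exact hlt
        · exact absurd heq.symm (hinj s' s hlt (by omega))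

/-- Every nontrivial doubled cyclic word contains two step-disjoint simple closed factors.
This is the combinatorial core of the fact that every nontrivial knot shadow has at least
two edge-disjoint straight-ahead cycles. -/
theorem two_disjoint_simple_closed_factors
    (n : ℕ) (hn : 1 ≤ n) (Λ : Type*) (w : ZMod (2 * n) → Λ)
    (hw : ∀ i : ZMod (2 * n), {j : ZMod (2 * n) | w j = w i}.ncard = 2) :
    ∃ (i₁ i₂ : ZMod (2 * n)) (k₁ k₂ : ℕ),
      k₁ ≤ 2 * n - 2 ∧ k₂ ≤ 2 * n - 2 ∧
      w i₁ = w (i₁ + ((k₁ : ZMod (2 * n)) + 1)) ∧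
      w i₂ = w (i₂ + ((k₂ : ZMod (2 * n)) + 1)) ∧
      (∀ s s' : ℕ, s ≤ k₁ → s' ≤ k₁ →
        w (i₁ + (s : ZMod (2 * n))) = w (i₁ + (s' : ZMod (2 * n))) → s = s') ∧
      (∀ s s' : ℕ, s ≤ k₂ → s' ≤ k₂ →
        w (i₂ + (s : ZMod (2 * n))) = w (i₂ + (s' : ZMod (2 * n))) → s = s') ∧
      Disjoint
        {p : ZMod (2 * n) × ZMod (2 * n) | ∃ s : ℕ, s ≤ k₁ ∧
          p = (i₁ + (s : ZMod (2 * n)), i₁ + (s : ZMod (2 * n)) + 1)}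
        {p : ZMod (2 * n) × ZMod (2 * n) | ∃ s : ℕ, s ≤ k₂ ∧
          p = (i₂ + (s : ZMod (2 * n)), i₂ + (s : ZMod (2 * n)) + 1)} := by
  have : NeZero (2 * n) := ⟨by omega⟩
  obtain ⟨j, hj, hj0⟩ := Set.exists_ne_of_one_lt_ncard (by rw [hw 0]; norm_num) (0 : ZMod (2 * n))
  have hlt := ZMod.val_lt j
  have hpos : 0 < j.val := ZMod.val_pos.mpr hj0
  have hjw : w (j.val : ZMod (2 * n)) = w 0 := by rw [ZMod.natCast_zmod_val]; exact hj
  obtain ⟨i₁, k₁, -, hb₁, hc₁, hs₁⟩ := exists_simple_closed_factor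
    (fun m : ℕ ↦ w (m : ZMod (2 * n))) hpos (by simpa using hjw.symm)
  obtain ⟨i₂, k₂, ha₂, hb₂, hc₂, hs₂⟩ := exists_simple_closed_factor
    (fun m : ℕ ↦ w (m : ZMod (2 * n))) hlt
    (by simp only [ZMod.natCast_self]; exact hjw)
  refine ⟨i₁, i₂, k₁, k₂, by omega, by omega, ?_, ?_, ?_, ?_, ?_⟩
  · simpa [add_assoc] using hc₁
  · simpa [add_assoc] using hc₂
  · simpa using hs₁
  · simpa using hs₂
  · rw [Set.disjoint_left]
    rintro _ ⟨s, hs, rfl⟩ ⟨s', hs', heq⟩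
    have hmod := (Prod.mk.inj heq).1
    rw [← Nat.cast_add, ← Nat.cast_add, ZMod.natCast_eq_natCast_iff', Nat.mod_eq_of_lt (by omega),
      Nat.mod_eq_of_lt (by omega)] at hmod
    omega
end

section
/- Let n ≥ 1 be an integer, let V be a finite set with |V| = n, and let D₁, …, D_p be subsets of V such that every element of V belongs to exactly two of the sets D₁, …, D_p. If p ≤ n^(1/3) (as real numbers), then there exist distinct indices r, s ∈ {1, …, p} such that |D_r ∩ D_s| ≥ 2·n^(1/3) (as real numbers). -/
/-- If every element of an `n`-element set `V` belongs to exactly two of the sets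
`D 1, …, D p`, and `p ≤ n^(1/3)`, then some two of the sets have at least `2·n^(1/3)`
common elements. -/
theorem exists_pair_with_large_intersection
    (n : ℕ) (hn : 1 ≤ n) (V : Type*) [Fintype V] (hV : Fintype.card V = n)
    (p : ℕ) (D : Fin p → Set V)
    (hD : ∀ v : V, {i : Fin p | v ∈ D i}.ncard = 2)
    (hp : (p : ℝ) ≤ (n : ℝ) ^ ((1 : ℝ) / 3)) :
    ∃ r s : Fin p, r ≠ s ∧
      2 * (n : ℝ) ^ ((1 : ℝ) / 3) ≤ ((D r ∩ D s).ncard : ℝ) := by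
  classical
  set c : ℝ := (n : ℝ) ^ ((1 : ℝ) / 3) with hc
  have hc0 : 0 ≤ c := by positivity
  have hc3 : c ^ 3 = n := by
    rw [hc, ← Real.rpow_natCast, ← Real.rpow_mul (Nat.cast_nonneg n)]
    norm_num
  let f : V → Finset (Fin p) := fun v => Finset.univ.filter fun i => v ∈ D i
  have hf : ∀ v ∈ (Finset.univ : Finset V),
      f v ∈ Finset.powersetCard 2 (Finset.univ : Finset (Fin p)) := by
    intro v _
    have h := hD v
    rw [Set.ncard_eq_toFinset_card'] at h
    simpa [f, Finset.mem_powersetCard] using h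
  have hne : (Finset.powersetCard 2 (Finset.univ : Finset (Fin p))).Nonempty := by
    obtain ⟨v⟩ : Nonempty V := Fintype.card_pos_iff.mp (by lia)
    exact ⟨f v, hf v (Finset.mem_univ v)⟩
  have hcard : (Finset.powersetCard 2 (Finset.univ : Finset (Fin p))).card • (2 * c) ≤
      ((Finset.univ : Finset V).card : ℝ) := by
    rw [Finset.card_powersetCard, Finset.card_univ, Finset.card_univ, Fintype.card_fin, hV,
      nsmul_eq_mul, Nat.cast_choose_two, ← hc3]
    have hp0 : (0 : ℝ) ≤ p := Nat.cast_nonneg p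
    have hpp : (p : ℝ) * (p - 1) ≤ c * c := by nlinarith
    nlinarith [mul_le_mul_of_nonneg_right hpp hc0]
  obtain ⟨t, ht, hle⟩ := Finset.exists_le_card_fiber_of_nsmul_le_card_of_maps_to hf hne hcard
  obtain ⟨r, s, hrs, rfl⟩ := Finset.card_eq_two.mp (Finset.mem_powersetCard.mp ht).2
  refine ⟨r, s, hrs, hle.trans ?_⟩
  rw [← Set.ncard_coe_finset]
  refine Nat.cast_le.mpr (Set.ncard_le_ncard ?_ (Set.toFinite _))
  intro v hv
  have hfv : f v = {r, s} := by simpa using hv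
  have hr : r ∈ f v := by simp [hfv]
  have hs : s ∈ f v := by simp [hfv]
  exact ⟨by simpa [f] using hr, by simpa [f] using hs⟩
end

section
/- Let β and ρ be simple closed curves in ℝ² such that every point of β ∩ ρ is a crossing of β and ρ. Then β ∩ ρ is a finite set of even cardinality. -/
/-- A simple closed curve: a subset of ℝ² homeomorphic to the unit circle. -/
def IsSimpleClosedCurve (c : Set (ℝ × ℝ)) : Prop :=
  Nonempty (c ≃ₜ Metric.sphere (0 : EuclideanSpace ℝ (Fin 2)) 1)

/-- An arc: a subset of ℝ² homeomorphic to the closed interval [0,1]. -/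
def IsArc (A : Set (ℝ × ℝ)) : Prop :=
  Nonempty (A ≃ₜ Set.Icc (0 : ℝ) 1)

/-- `a` is an endpoint of the arc `A` : `a ∈ A` and `A \ {a}` is connected. -/
def IsEndpointOf (a : ℝ × ℝ) (A : Set (ℝ × ℝ)) : Prop :=
  a ∈ A ∧ IsConnected (A \ {a})

/-- A digon of the pair of simple closed curves `(β, ρ)`. -/
def IsDigon (β ρ α γ : Set (ℝ × ℝ)) : Prop :=
  IsArc α ∧ IsArc γ ∧ α ⊆ β ∧ γ ⊆ ρ ∧
  ∃ x y : ℝ × ℝ, x ≠ y ∧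
    {a | IsEndpointOf a α} = {x, y} ∧
    {a | IsEndpointOf a γ} = {x, y} ∧
    β ∩ γ = {x, y} ∧
    ρ ∩ α = {x, y}

/-- `z` is a crossing of `β` and `ρ`. -/
def IsCrossing (β ρ : Set (ℝ × ℝ)) (z : ℝ × ℝ) : Prop :=
  ∃ (U : Set (ℝ × ℝ)) (_ : IsOpen U) (hz : z ∈ U) (h : U ≃ₜ ℝ × ℝ),
    h ⟨z, hz⟩ = (0, 0) ∧
    ⇑h '' {p : U | (p : ℝ × ℝ) ∈ β} = {q : ℝ × ℝ | q.2 = 0} ∧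
    ⇑h '' {p : U | (p : ℝ × ℝ) ∈ ρ} = {q : ℝ × ℝ | q.1 = 0}

/-- `z` is a tangential intersection of `β` and `ρ`. -/
def IsTangential (β ρ : Set (ℝ × ℝ)) (z : ℝ × ℝ) : Prop :=
  ∃ (U : Set (ℝ × ℝ)) (_ : IsOpen U) (hz : z ∈ U) (h : U ≃ₜ ℝ × ℝ),
    h ⟨z, hz⟩ = (0, 0) ∧
    ⇑h '' {p : U | (p : ℝ × ℝ) ∈ β} = {q : ℝ × ℝ | q.2 = 0} ∧
    ⇑h '' {p : U | (p : ℝ × ℝ) ∈ ρ} ⊆ {q : ℝ × ℝ | 0 ≤ q.2} ∧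
    ⇑h '' {p : U | (p : ℝ × ℝ) ∈ ρ} ∩ {q : ℝ × ℝ | q.2 = 0} = {((0 : ℝ), (0 : ℝ))}

open Set Filter Topology

/-- `f` has a continuous square root on `S`. -/
def HasSqrtOn {X : Type*} [TopologicalSpace X] (f : X → ℂ) (S : Set X) : Prop :=
  ∃ r : X → ℂ, ContinuousOn r S ∧ ∀ x ∈ S, r x ^ 2 = f x

section HasSqrtOn

variable {X : Type*} [TopologicalSpace X] {f g : X → ℂ} {S T : Set X}

theorem HasSqrtOn.mono (h : HasSqrtOn f S) (hTS : T ⊆ S) : HasSqrtOn f T :=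
  let ⟨r, hr, hrf⟩ := h
  ⟨r, hr.mono hTS, fun x hx => hrf x (hTS hx)⟩

theorem HasSqrtOn.congr (h : HasSqrtOn f S) (hfg : EqOn f g S) : HasSqrtOn g S :=
  let ⟨r, hr, hrf⟩ := h
  ⟨r, hr, fun x hx => (hrf x hx).trans (hfg hx)⟩

theorem HasSqrtOn.mul (hf : HasSqrtOn f S) (hg : HasSqrtOn g S) :
    HasSqrtOn (fun x => f x * g x) S := by
  obtain ⟨r, hr, hrf⟩ := hf
  obtain ⟨s, hs, hsg⟩ := hg
  exact ⟨fun x => r x * s x, hr.mul hs, fun x hx => by simp only [mul_pow, hrf x hx, hsg x hx]⟩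

theorem HasSqrtOn.div (hf : HasSqrtOn f S) (hg : HasSqrtOn g S) (h0 : ∀ x ∈ S, g x ≠ 0) :
    HasSqrtOn (fun x => f x / g x) S := by
  obtain ⟨r, hr, hrf⟩ := hf
  obtain ⟨s, hs, hsg⟩ := hg
  refine ⟨fun x => r x / s x, hr.div hs fun x hx hs0 => h0 x hx ?_,
    fun x hx => by simp only [div_pow, hrf x hx, hsg x hx]⟩
  rw [← hsg x hx, hs0, zero_pow two_ne_zero]

theorem hasSqrtOn_of_mem_slitPlane (hf : ContinuousOn f S)
    (h : ∀ x ∈ S, f x ∈ Complex.slitPlane) : HasSqrtOn f S := by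
  refine ⟨fun x => Complex.exp (Complex.log (f x) / 2),
    ((hf.clog h).div_const 2).cexp, fun x hx => ?_⟩
  simp only
  rw [← Complex.exp_nat_mul, Nat.cast_ofNat, mul_div_cancel₀ _ (two_ne_zero' ℂ),
    Complex.exp_log (Complex.slitPlane_ne_zero (h x hx))]

/-- A nonvanishing function homotopic to a constant through nonvanishing functions has a
continuous square root. -/
theorem hasSqrtOn_of_homotopy {H : ℝ → X → ℂ} {c : ℂ}
    (hH : ContinuousOn (Function.uncurry H) (Icc 0 1 ×ˢ S))
    (h0 : ∀ t ∈ Icc (0 : ℝ) 1, ∀ x ∈ S, H t x ≠ 0) (hc : ∀ x ∈ S, H 0 x = c) :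
    HasSqrtOn (H 1) S := by
  classical
  rcases S.eq_empty_or_nonempty with rfl | ⟨x₀, hx₀⟩
  · exact ⟨0, continuousOn_empty _, fun x hx => hx.elim⟩
  have hc0 : c ≠ 0 := hc x₀ hx₀ ▸ h0 0 (by simp) x₀ hx₀
  let F : C(unitInterval × S, {z : ℂ // z ≠ 0}) :=
    ⟨fun p => ⟨H p.1 p.2, h0 _ p.1.2 _ p.2.2⟩, by
      refine Continuous.subtype_mk ?_ _
      exact hH.comp_continuous (f := fun p : unitInterval × S => ((p.1 : ℝ), (p.2 : X)))
        (by fun_prop) fun p => ⟨p.1.2, p.2.2⟩⟩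
  have hF : ∀ a : S, F (0, a) =
      ⟨Complex.exp ((ContinuousMap.const S (Complex.log c)) a), Complex.exp_ne_zero _⟩ := by
    intro a
    apply Subtype.ext
    simp [F, Complex.exp_log hc0, hc a a.2]
  let L := Complex.isCoveringMap_exp.liftHomotopy F (ContinuousMap.const S (Complex.log c)) hF
  have hL : ∀ p, Complex.exp (L p) = H p.1 p.2 := fun p =>
    congrArg Subtype.val (congrFun (Complex.isCoveringMap_exp.liftHomotopy_lifts F _ hF) p)
  refine ⟨fun x => if hx : x ∈ S then Complex.exp (L (1, ⟨x, hx⟩) / 2) else 0, ?_,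
    fun x hx => ?_⟩
  · rw [continuousOn_iff_continuous_domRestrict]
    have : Continuous fun x : S => Complex.exp (L (1, x) / 2) := by fun_prop
    convert this using 2 with x
    simp
  · simp only [hx, dif_pos]
    rw [← Complex.exp_nat_mul, Nat.cast_ofNat, mul_div_cancel₀ _ (two_ne_zero' ℂ), hL]
    simp

end HasSqrtOn

/-- The function `x ↦ x - a` has no continuous square root on a punctured neighborhood of `a`. -/
theorem not_hasSqrtOn_sub {a : ℂ} {W : Set ℂ} (hW : W ∈ 𝓝 a) :
    ¬ HasSqrtOn (fun x => x - a) (W \ {a}) := by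
  rintro ⟨r, hr, hrf⟩
  obtain ⟨ε, hε, hεW⟩ := Metric.mem_nhds_iff.1 hW
  let q : ℝ → ℂ := fun t => a + (ε / 2 : ℝ) * Complex.exp (t * Complex.I)
  have hqc : Continuous q := by fun_prop
  have hq : ∀ t, q t ∈ W \ {a} := by
    intro t
    refine ⟨hεW ?_, ?_⟩
    · simp only [q, Metric.mem_ball, dist_self_add_left, norm_mul, Complex.norm_real,
        Complex.norm_exp_ofReal_mul_I, Real.norm_eq_abs, abs_of_pos (half_pos hε)]
      linarith
    · simp [q, hε.ne']
  let s : ℝ → ℂ := fun t => (Real.sqrt (ε / 2) : ℝ) * Complex.exp (t / 2 * Complex.I)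
  have hsc : Continuous s := by fun_prop
  have hs : ∀ t, s t ^ 2 = (r (q t)) ^ 2 := by
    intro t
    rw [hrf _ (hq t)]
    simp only [s, q, mul_pow, ← Complex.exp_nat_mul, ← Complex.ofReal_pow,
      Real.sq_sqrt (half_pos hε).le, add_sub_cancel_left]
    congr 2
    push_cast
    ring
  have hs0 : ∀ t, s t ≠ 0 := fun t => mul_ne_zero
    (Complex.ofReal_ne_zero.2 (Real.sqrt_pos.2 (half_pos hε)).ne') (Complex.exp_ne_zero _)
  have key := isPreconnected_univ.eq_or_eq_neg_of_sq_eq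
    (hr.comp_continuous hqc hq).continuousOn hsc.continuousOn (fun t _ => (hs t).symm)
    (fun {t} _ => hs0 t)
  have hper : (r ∘ q) (2 * Real.pi) = (r ∘ q) 0 := by simp [q, Complex.exp_two_pi_mul_I]
  have hanti : s (2 * Real.pi) = - s 0 := by
    simp [s, mul_div_cancel_left₀, Complex.exp_pi_mul_I]
  have : s (2 * Real.pi) = s 0 := by
    rcases key with h | h
    · rw [← h (mem_univ _), ← h (mem_univ _), hper]
    · have h1 := h (mem_univ (2 * Real.pi))
      have h2 := h (mem_univ 0)
      simp only [Pi.neg_apply, hper] at h1 h2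
      exact neg_injective (h1.symm.trans h2)
  rw [hanti, neg_eq_iff_add_eq_zero, ← two_mul] at this
  exact hs0 0 ((mul_eq_zero.1 this).resolve_left two_ne_zero)

theorem eventually_hasSqrtOn_sub_iff {c : Set ℂ} (hc : IsClosed c) {z : ℂ} (hz : z ∉ c) :
    ∀ᶠ w in 𝓝 z, (HasSqrtOn (fun x => x - w) c ↔ HasSqrtOn (fun x => x - z) c) := by
  obtain ⟨δ, hδ, hball⟩ := Metric.mem_nhds_iff.1 (hc.isOpen_compl.mem_nhds hz)
  filter_upwards [Metric.ball_mem_nhds z hδ] with w hw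
  have hne : ∀ y ∈ Metric.ball z δ, ∀ x ∈ c, x - y ≠ 0 := fun y hy x hx h =>
    hball hy (sub_eq_zero.1 h ▸ hx)
  have hz0 := hne z (Metric.mem_ball_self hδ)
  have hw0 := hne w hw
  have hq : HasSqrtOn (fun x => (x - w) / (x - z)) c := by
    refine hasSqrtOn_of_mem_slitPlane (ContinuousOn.div (by fun_prop) (by fun_prop) hz0) ?_
    intro x hx
    have : (x - w) / (x - z) = 1 + (z - w) / (x - z) := by
      field_simp [hz0 x hx]
      ring
    rw [this]
    apply Complex.mem_slitPlane_of_norm_lt_one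
    rw [norm_div, div_lt_one (norm_pos_iff.2 (hz0 x hx)), ← dist_eq_norm, ← dist_eq_norm,
      dist_comm]
    refine lt_of_lt_of_le hw (not_lt.1 fun h => ?_)
    exact hball h hx
  constructor
  · intro h
    refine (h.div hq fun x hx => div_ne_zero (hw0 x hx) (hz0 x hx)).congr fun x hx => ?_
    have h1 := hw0 x hx
    have h2 := hz0 x hx
    field_simp
  · intro h
    refine (h.mul hq).congr fun x hx => ?_
    have h2 := hz0 x hx
    field_simp

/-- `p` is a parametrization of `c` that is injective up to translation by integers. -/
structure IsPeriodicParam (p : ℝ → ℂ) (c : Set ℂ) : Prop where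
  continuous : Continuous p
  range_eq : range p = c
  eq_iff : ∀ s t, p s = p t ↔ ∃ n : ℤ, t = s + n

namespace IsPeriodicParam

variable {p : ℝ → ℂ} {c : Set ℂ}

theorem mem (hp : IsPeriodicParam p c) (t : ℝ) : p t ∈ c := hp.range_eq ▸ mem_range_self t

theorem translate (hp : IsPeriodicParam p c) (a : ℝ) :
    IsPeriodicParam (fun t => p (a + t)) c where
  continuous := hp.continuous.comp (continuous_const.add continuous_id)
  range_eq := by
    rw [← hp.range_eq]
    exact (Equiv.addLeft a).surjective.range_comp p
  eq_iff s t := by simp only [hp.eq_iff, add_assoc, add_right_inj]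

theorem exists_mem_Ico (hp : IsPeriodicParam p c) (a : ℝ) {z : ℂ} (hz : z ∈ c) :
    ∃ t ∈ Ico a (a + 1), p t = z := by
  obtain ⟨s, rfl⟩ := hp.range_eq ▸ hz
  refine ⟨toIcoMod one_pos a s, toIcoMod_mem_Ico one_pos a s, (hp.eq_iff _ _).2
    ⟨toIcoDiv one_pos a s, ?_⟩⟩
  have := toIcoMod_add_toIcoDiv_zsmul one_pos a s
  simpa using this.symm

theorem eq_of_abs_sub_lt_one (hp : IsPeriodicParam p c) {s t : ℝ} (h : p s = p t)
    (hst : |t - s| < 1) : s = t := by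
  obtain ⟨n, rfl⟩ := (hp.eq_iff _ _).1 h
  rw [add_sub_cancel_left] at hst
  have : n = 0 := Int.abs_lt_one_iff.1 (by exact_mod_cast hst)
  simp [this]

theorem injOn_Ico (hp : IsPeriodicParam p c) (a : ℝ) : InjOn p (Ico a (a + 1)) := by
  intro s hs t ht h
  refine hp.eq_of_abs_sub_lt_one h (abs_lt.2 ⟨?_, ?_⟩) <;> linarith [hs.1, hs.2, ht.1, ht.2]

theorem map_one (hp : IsPeriodicParam p c) : p 0 = p 1 := (hp.eq_iff _ _).2 ⟨1, by simp⟩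

theorem isCompact (hp : IsPeriodicParam p c) : IsCompact c := by
  convert (isCompact_Icc (a := (0 : ℝ)) (b := 0 + 1)).image hp.continuous
  apply subset_antisymm
  · intro z hz
    obtain ⟨t, ht, rfl⟩ := hp.exists_mem_Ico 0 hz
    exact ⟨t, Ico_subset_Icc_self ht, rfl⟩
  · rintro _ ⟨t, -, rfl⟩
    exact hp.mem t

theorem isPreconnected_diff_singleton (hp : IsPeriodicParam p c) {z : ℂ} (hz : z ∈ c) :
    IsPreconnected (c \ {z}) := by
  obtain ⟨a, rfl⟩ := hp.range_eq ▸ hz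
  convert (isPreconnected_Ioo (a := a) (b := a + 1)).image p hp.continuous.continuousOn
  apply subset_antisymm
  · rintro z ⟨hz, hza⟩
    obtain ⟨t, ht, rfl⟩ := hp.exists_mem_Ico a hz
    refine ⟨t, ⟨lt_of_le_of_ne ht.1 ?_, ht.2⟩, rfl⟩
    rintro rfl
    exact hza rfl
  · rintro _ ⟨t, ht, rfl⟩
    refine ⟨hp.mem t, fun h => ht.1.ne' ?_⟩
    exact hp.injOn_Ico a ⟨ht.1.le, ht.2⟩ (by simp) h

/-- Functions on the parameter interval with equal end values descend to the curve. -/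
theorem exists_descend (hp : IsPeriodicParam p c) {r : ℝ → ℂ} (hr : ContinuousOn r (Icc 0 1))
    (h01 : r 0 = r 1) :
    ∃ s : ℂ → ℂ, ContinuousOn s c ∧ ∀ t ∈ Icc (0 : ℝ) 1, s (p t) = r t := by
  classical
  let q : C(Icc (0 : ℝ) 1, c) :=
    ⟨fun t => ⟨p t, hp.mem t⟩, (hp.continuous.comp continuous_subtype_val).subtype_mk _⟩
  have hqs : Function.Surjective q := by
    rintro ⟨z, hz⟩
    obtain ⟨t, ht, rfl⟩ := hp.exists_mem_Ico 0 hz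
    exact ⟨⟨t, ht.1, by linarith [ht.2]⟩, rfl⟩
  have hQ : IsQuotientMap q := q.continuous.isClosedMap.isQuotientMap q.continuous hqs
  have key : ∀ a b : Icc (0 : ℝ) 1, a ≤ b → q a = q b → r a = r b := by
    rintro ⟨a, ha⟩ ⟨b, hb⟩ hab h
    have h' : p a = p b := congrArg Subtype.val h
    rcases lt_or_ge |b - a| 1 with h1 | h1
    · exact congrArg r (hp.eq_of_abs_sub_lt_one h' h1)
    · have hab' : a ≤ b := hab
      rw [abs_of_nonneg (sub_nonneg.2 hab')] at h1
      have ha0 : a = 0 := by linarith [ha.1, hb.2]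
      have hb1 : b = 1 := by linarith [ha.1, hb.2]
      simp only [ha0, hb1, h01]
  let R : C(Icc (0 : ℝ) 1, ℂ) := ⟨fun t => r t, hr.domRestrict⟩
  have hR : Function.FactorsThrough R q := fun a b h =>
    (le_total a b).elim (fun hab => key a b hab h) fun hab => (key b a hab h.symm).symm
  let s := hQ.lift R hR
  refine ⟨fun z => if hz : z ∈ c then s ⟨z, hz⟩ else 0, ?_, fun t ht => ?_⟩
  · rw [continuousOn_iff_continuous_domRestrict]
    convert s.continuous using 2 with x
    simp
  · simp only [hp.mem t, dif_pos]
    exact DFunLike.congr_fun (hQ.lift_comp R hR) (⟨t, ht⟩ : Icc (0 : ℝ) 1)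

/-- The quotient of two nonvanishing functions without square root on a closed curve has a
square root. -/
theorem hasSqrtOn_div (hp : IsPeriodicParam p c) {f g : ℂ → ℂ} (hf : ContinuousOn f c)
    (hg : ContinuousOn g c) (hf0 : ∀ x ∈ c, f x ≠ 0) (hg0 : ∀ x ∈ c, g x ≠ 0)
    (hfs : ¬ HasSqrtOn f c) (hgs : ¬ HasSqrtOn g c) :
    HasSqrtOn (fun x => f x / g x) c := by
  have descend : ∀ {F : ℂ → ℂ} {r : ℝ → ℂ}, ContinuousOn r (Icc 0 1) →
      (∀ t ∈ Icc (0 : ℝ) 1, r t ^ 2 = F (p t)) → r 0 = r 1 → HasSqrtOn F c := by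
    intro F r hr hrF h01
    obtain ⟨s, hs, hsr⟩ := hp.exists_descend hr h01
    refine ⟨s, hs, fun x hx => ?_⟩
    obtain ⟨t, ht, rfl⟩ := hp.exists_mem_Ico 0 hx
    have ht' : t ∈ Icc (0 : ℝ) 1 := ⟨ht.1, by linarith [ht.2]⟩
    rw [hsr t ht', hrF t ht']
  have lift : ∀ {F : ℂ → ℂ}, ContinuousOn F c → (∀ x ∈ c, F x ≠ 0) → ¬ HasSqrtOn F c →
      ∃ r : ℝ → ℂ, ContinuousOn r (Icc 0 1) ∧ (∀ t ∈ Icc (0 : ℝ) 1, r t ^ 2 = F (p t)) ∧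
        r 1 = - r 0 := by
    intro F hF hF0 hFs
    have : HasSqrtOn ((fun (u t : ℝ) => F (p (u * t))) 1) (Icc 0 1) := by
      refine hasSqrtOn_of_homotopy (H := fun (u t : ℝ) => F (p (u * t))) (c := F (p 0)) ?_ ?_ ?_
      · refine Continuous.continuousOn (hF.comp_continuous
          (f := fun x : ℝ × ℝ => p (x.1 * x.2)) ?_ fun _ => hp.mem _)
        exact hp.continuous.comp (by fun_prop)
      · exact fun _ _ _ _ => hF0 _ (hp.mem _)
      · simp
    obtain ⟨r, hr, hrF⟩ := this
    simp only [one_mul] at hrF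
    refine ⟨r, hr, hrF, ?_⟩
    have : r 1 ^ 2 = r 0 ^ 2 := by rw [hrF 1 (by simp), hrF 0 (by simp), hp.map_one]
    rcases sq_eq_sq_iff_eq_or_eq_neg.1 this with h | h
    · exact absurd (descend hr hrF h.symm) hFs
    · exact h
  obtain ⟨r, hr, hrf, hr1⟩ := lift hf hf0 hfs
  obtain ⟨s, hs, hsg, hs1⟩ := lift hg hg0 hgs
  refine descend (r := fun t => r t / s t) (hr.div hs fun t ht h0 => ?_) (fun t ht => ?_) ?_
  · exact hg0 _ (hp.mem t) (by rw [← hsg t ht, h0, zero_pow two_ne_zero])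
  · simp only [div_pow, hrf t ht, hsg t ht]
  · simp only [hr1, hs1, neg_div_neg_eq]

end IsPeriodicParam

/-- If `k` is a chart of the plane in which the closed curve `c` is the horizontal axis, then
points on the vertical axis on opposite sides of `c` are separated by `c` modulo 2. -/
theorem not_hasSqrtOn_div_of_chart {c : Set ℂ} {k : ℝ × ℝ → ℂ} (hk : IsOpenEmbedding k)
    (hkc : ∀ q, k q ∈ c ↔ q.2 = 0) (hconn : IsPreconnected (c \ {k (0, 0)})) {a b : ℝ}
    (ha : a < 0) (hb : 0 < b) :
    ¬ HasSqrtOn (fun x => (x - k (0, b)) / (x - k (0, a))) c := by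
  rintro ⟨σ, hσ, hσg⟩
  set g : ℂ → ℂ := fun x => (x - k (0, b)) / (x - k (0, a)) with hg
  have hkcont := hk.continuous
  have hg0 : ∀ x, x ≠ k (0, b) → x ≠ k (0, a) → g x ≠ 0 := fun x hxb hxa =>
    div_ne_zero (sub_ne_zero.2 hxb) (sub_ne_zero.2 hxa)
  have hgc : ContinuousOn g {k (0, a)}ᶜ :=
    ContinuousOn.div (by fun_prop) (by fun_prop) fun x hx => sub_ne_zero.2 hx
  -- a square root of `g` off the vertical segment
  set I : Set ℂ := k '' ({0} ×ˢ Icc a b) with hI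
  have hIclosed : IsClosed I := ((isCompact_singleton.prod isCompact_Icc).image hkcont).isClosed
  have hkI : ∀ q, k q ∈ I ↔ q.1 = 0 ∧ q.2 ∈ Icc a b := fun q => by
    rw [hI, hk.injective.mem_set_image]
    simp
  have hneI : ∀ x ∉ I, x ≠ k (0, b) ∧ x ≠ k (0, a) := fun x hx =>
    ⟨fun h => hx (h ▸ (hkI _).2 ⟨rfl, by simp; linarith⟩),
      fun h => hx (h ▸ (hkI _).2 ⟨rfl, by simp; linarith⟩)⟩
  obtain ⟨τ, hτ, hτg⟩ : HasSqrtOn g Iᶜ := by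
    have : HasSqrtOn ((fun (t : ℝ) (x : ℂ) => (x - k (0, a + t * (b - a))) / (x - k (0, a))) 1)
        Iᶜ := by
      refine hasSqrtOn_of_homotopy (c := 1)
        (H := fun (t : ℝ) (x : ℂ) => (x - k (0, a + t * (b - a))) / (x - k (0, a))) ?_ ?_ ?_
      · refine ContinuousOn.div (f := fun p : ℝ × ℂ => p.2 - k (0, a + p.1 * (b - a)))
          (g := fun p : ℝ × ℂ => p.2 - k (0, a)) (by fun_prop) (by fun_prop) ?_
        exact fun p hp => sub_ne_zero.2 (hneI _ hp.2).2
      · intro t ht x hx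
        refine div_ne_zero (sub_ne_zero.2 fun h => hx (h ▸ (hkI _).2 ⟨rfl, ?_, ?_⟩))
          (sub_ne_zero.2 (hneI _ hx).2)
        · simp only; nlinarith [ht.1, ht.2]
        · simp only; nlinarith [ht.1, ht.2]
      · intro x hx
        simp only [zero_mul, add_zero]
        exact div_self (sub_ne_zero.2 (hneI _ hx).2)
    refine this.congr fun x _ => ?_
    simp [hg]
  -- a square root of `g` in the chart, off two vertical rays
  set C : Set (ℝ × ℝ) := {q | q.1 ≠ 0 ∨ a < q.2 ∧ q.2 < b} with hC
  have hCopen : IsOpen C := (isOpen_ne_fun continuous_fst continuous_const).union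
    ((isOpen_lt continuous_const continuous_snd).inter
      (isOpen_lt continuous_snd continuous_const))
  have hneC : ∀ q ∈ C, k q ≠ k (0, b) ∧ k q ≠ k (0, a) := by
    intro q hq
    constructor <;> intro h <;> rw [hk.injective h] at hq <;> simp [hC] at hq
  obtain ⟨κ, hκ, hκg⟩ : HasSqrtOn (fun q => g (k q)) C := by
    have hstar : ∀ t ∈ Icc (0 : ℝ) 1, ∀ q ∈ C, t • q ∈ C := by
      intro t ht q hq
      rcases ht.1.eq_or_lt with rfl | ht0
      · simp [hC, ha, hb]
      rcases hq with hq | hq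
      · exact Or.inl (mul_ne_zero ht0.ne' hq)
      · refine Or.inr ⟨?_, ?_⟩ <;> simp only [Prod.smul_snd, smul_eq_mul] <;>
          nlinarith [ht.1, ht.2, hq.1, hq.2]
    have : HasSqrtOn ((fun (t : ℝ) (q : ℝ × ℝ) => g (k (t • q))) 1) C := by
      refine hasSqrtOn_of_homotopy (c := g (k 0))
        (H := fun (t : ℝ) (q : ℝ × ℝ) => g (k (t • q))) ?_ ?_ ?_
      · refine hgc.comp (f := fun p : ℝ × (ℝ × ℝ) => k (p.1 • p.2)) (by fun_prop) ?_
        exact fun p hp => (hneC _ (hstar _ hp.1 _ hp.2)).2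
      · exact fun t ht q hq => hg0 _ (hneC _ (hstar _ ht _ hq)).1 (hneC _ (hstar _ ht _ hq)).2
      · simp
    simpa using this
  have hcI : c \ {k (0, 0)} ⊆ Iᶜ := by
    rintro x ⟨hx, hx0⟩ hxI
    obtain ⟨⟨u, v⟩, ⟨hu, -⟩, rfl⟩ := hxI
    have hv := (hkc _).1 hx
    simp only [mem_singleton_iff] at hu hv
    exact hx0 (by rw [hu, hv]; rfl)
  have hτ0 : ∀ x ∈ Iᶜ, τ x ≠ 0 := fun x hx h0 => hg0 x (hneI x hx).1 (hneI x hx).2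
    ((hτg x hx).symm.trans (by rw [h0, zero_pow two_ne_zero]))
  -- normalize signs
  obtain ⟨τ, hτ, hτg, hτσ⟩ : ∃ τ : ℂ → ℂ, ContinuousOn τ Iᶜ ∧ (∀ x ∈ Iᶜ, τ x ^ 2 = g x) ∧
      EqOn σ τ (c \ {k (0, 0)}) := by
    rcases hconn.eq_or_eq_neg_of_sq_eq (hσ.mono sdiff_subset) (hτ.mono hcI)
      (fun x hx => (hσg x hx.1).trans (hτg x (hcI hx)).symm) (fun {x} hx => hτ0 x (hcI hx)) with h | h
    · exact ⟨τ, hτ, hτg, h⟩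
    · exact ⟨-τ, hτ.neg, fun x hx => by simp [hτg x hx], h⟩
  have hκ0 : ∀ q ∈ C, κ q ≠ 0 := fun q hq h0 => hg0 _ (hneC q hq).1 (hneC q hq).2
    ((hκg q hq).symm.trans (by rw [h0, zero_pow two_ne_zero]))
  have hAC : univ ×ˢ {0} ⊆ C := by
    rintro ⟨u, v⟩ ⟨-, hv⟩
    rw [mem_singleton_iff] at hv
    subst hv
    exact Or.inr ⟨ha, hb⟩
  have hAc : MapsTo k (univ ×ˢ {0}) c := fun q hq => (hkc q).2 hq.2
  obtain ⟨κ, hκ, hκg, hκ0, hκσ⟩ : ∃ κ : ℝ × ℝ → ℂ, ContinuousOn κ C ∧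
      (∀ q ∈ C, κ q ^ 2 = g (k q)) ∧ (∀ q ∈ C, κ q ≠ 0) ∧
      EqOn (fun q => σ (k q)) κ (univ ×ˢ {0}) := by
    rcases (isPreconnected_univ.prod isPreconnected_singleton).eq_or_eq_neg_of_sq_eq
      (f := fun q => σ (k q)) (hσ.comp hkcont.continuousOn hAc) (hκ.mono hAC)
      (fun x hx => (hσg _ (hAc hx)).trans (hκg x (hAC hx)).symm)
      (fun {x} hx => hκ0 x (hAC hx)) with h | h
    · exact ⟨κ, hκ, hκg, hκ0, h⟩
    · exact ⟨-κ, hκ.neg, fun x hx => by simp [hκg x hx], fun x hx => by simpa using hκ0 x hx, h⟩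
  have hside : ∀ J : Set ℝ, IsPreconnected J → 0 ∉ J → J.Nonempty →
      EqOn (fun q => τ (k q)) κ (J ×ˢ univ) := by
    rintro J hJ hJ0 ⟨j, hj⟩
    have hne : ∀ q ∈ J ×ˢ (univ : Set ℝ), q.1 ≠ 0 := fun q hq h => hJ0 (h ▸ hq.1)
    have hJC : J ×ˢ (univ : Set ℝ) ⊆ C := fun q hq => Or.inl (hne q hq)
    have hJI : MapsTo k (J ×ˢ univ) Iᶜ := fun q hq h => hne q hq ((hkI q).1 h).1
    refine (hJ.prod isPreconnected_univ).eq_of_sq_eq (f := fun q => τ (k q))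
      (hτ.comp hkcont.continuousOn hJI) (hκ.mono hJC)
      (fun q hq => (hτg _ (hJI hq)).trans (hκg q (hJC hq)).symm)
      (fun {q} hq => hκ0 q (hJC hq)) (y := (j, 0)) ⟨hj, mem_univ _⟩ ?_
    rw [← hκσ (show (j, (0 : ℝ)) ∈ univ ×ˢ {0} from ⟨mem_univ _, rfl⟩)]
    refine (hτσ ⟨(hkc _).2 rfl, fun h => ?_⟩).symm
    have hj0 : j = 0 := congrArg Prod.fst (hk.injective h)
    exact hJ0 (hj0 ▸ hj)
  have hτκ : ∀ q : ℝ × ℝ, q.1 ≠ 0 → τ (k q) = κ q := by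
    intro q hq
    rcases hq.lt_or_gt with h | h
    · exact hside (Iio 0) isPreconnected_Iio (by simp) ⟨-1, by simp⟩ ⟨h, mem_univ _⟩
    · exact hside (Ioi 0) isPreconnected_Ioi (by simp) ⟨1, by simp⟩ ⟨h, mem_univ _⟩
  -- glue the two square roots
  have hglue : HasSqrtOn (fun q => g (k q)) {q : ℝ × ℝ | q ≠ (0, b) ∧ q ≠ (0, a)} := by
    classical
    let θ : ℝ × ℝ → ℂ := fun q => if q ∈ C then κ q else τ (k q)
    have hθC : EqOn θ κ C := fun q hq => if_pos hq
    have hθI : EqOn θ (fun q => τ (k q)) (k ⁻¹' Iᶜ) := by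
      intro q hq
      by_cases hqC : q ∈ C
      · rw [hθC hqC]
        refine (hτκ q fun h => ?_).symm
        rcases hqC with h' | h'
        · exact h' h
        · exact hq ((hkI q).2 ⟨h, h'.1.le, h'.2.le⟩)
      · exact if_neg hqC
    have hcover : {q : ℝ × ℝ | q ≠ (0, b) ∧ q ≠ (0, a)} ⊆ C ∪ k ⁻¹' Iᶜ := by
      rintro ⟨u, v⟩ ⟨h1, h2⟩
      by_contra h
      have h3 : u = 0 := by
        by_contra h3
        exact h (Or.inl (Or.inl h3))
      have h4 : ¬ (a < v ∧ v < b) := fun h4 => h (Or.inl (Or.inr h4))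
      have h5 : a ≤ v ∧ v ≤ b := by
        by_contra h5
        exact h (Or.inr fun hh => h5 ((hkI _).1 hh).2)
      subst h3
      rcases h5.1.eq_or_lt with h6 | h6
      · exact h2 (by rw [h6])
      · exact h1 (by rw [le_antisymm h5.2 (not_lt.1 fun h7 => h4 ⟨h6, h7⟩)])
    have hKopen : IsOpen (k ⁻¹' Iᶜ) := hIclosed.isOpen_compl.preimage hkcont
    refine HasSqrtOn.mono ⟨θ, ?_, ?_⟩ hcover
    · refine ContinuousOn.union_of_isOpen (hκ.congr hθC) ?_ hCopen hKopen
      exact (hτ.comp hkcont.continuousOn (mapsTo_preimage k _)).congr hθI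
    · rintro q (hq | hq)
      · rw [hθC hq, hκg q hq]
      · rw [hθI hq]
        exact hτg _ hq
  have hglue' : HasSqrtOn g (k '' {q : ℝ × ℝ | q ≠ (0, b) ∧ q ≠ (0, a)}) := by
    obtain ⟨θ, hθ, hθg⟩ := hglue
    let e := hk.toOpenPartialHomeomorph k
    have he : ∀ q, e.symm (k q) = q := fun q => e.left_inv (mem_univ q)
    refine ⟨fun x => θ (e.symm x), ?_, ?_⟩
    · refine hθ.comp (e.continuousOn_symm.mono ?_) ?_
      · rintro _ ⟨q, -, rfl⟩
        exact e.map_source (mem_univ q)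
      · rintro _ ⟨q, hq, rfl⟩
        rwa [he]
    · rintro _ ⟨q, hq, rfl⟩
      simp only [he]
      exact hθg q hq
  -- contradiction near `k (0, b)`
  have hab : k (0, b) ≠ k (0, a) := fun h => by
    have := congrArg Prod.snd (hk.injective h)
    simp only at this
    linarith
  set δ := dist (k (0, a)) (k (0, b)) with hδ
  have hδ0 : 0 < δ := dist_pos.2 hab.symm
  have hW : range k ∩ Metric.ball (k (0, b)) δ ∈ 𝓝 (k (0, b)) :=
    inter_mem (hk.isOpen_range.mem_nhds (mem_range_self _)) (Metric.ball_mem_nhds _ hδ0)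
  have hWa : ∀ x ∈ range k ∩ Metric.ball (k (0, b)) δ, x - k (0, a) ≠ 0 := by
    rintro x ⟨-, hx⟩ h
    rw [sub_eq_zero.1 h, Metric.mem_ball] at hx
    exact hx.ne rfl
  refine not_hasSqrtOn_sub hW ?_
  have h1 : HasSqrtOn (fun x => (x - k (0, a)) / (k (0, b) - k (0, a)))
      (range k ∩ Metric.ball (k (0, b)) δ) := by
    refine hasSqrtOn_of_mem_slitPlane (by fun_prop) ?_
    rintro x ⟨-, hx⟩
    have h0 : k (0, b) - k (0, a) ≠ 0 := sub_ne_zero.2 hab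
    have : (x - k (0, a)) / (k (0, b) - k (0, a)) =
        1 + (x - k (0, b)) / (k (0, b) - k (0, a)) := by
      field_simp
      ring
    rw [this]
    apply Complex.mem_slitPlane_of_norm_lt_one
    rw [norm_div, div_lt_one (norm_pos_iff.2 h0), ← dist_eq_norm, ← dist_eq_norm,
      dist_comm (k (0, b))]
    exact hx
  have h2 : HasSqrtOn (fun _ : ℂ => k (0, b) - k (0, a))
      (range k ∩ Metric.ball (k (0, b)) δ) := by
    obtain ⟨s, hs⟩ := IsAlgClosed.exists_pow_nat_eq (k (0, b) - k (0, a)) two_pos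
    exact ⟨fun _ => s, continuousOn_const, fun _ _ => hs⟩
  have h3 : HasSqrtOn g ((range k ∩ Metric.ball (k (0, b)) δ) \ {k (0, b)}) := by
    refine hglue'.mono ?_
    rintro _ ⟨⟨⟨q, rfl⟩, hx⟩, hxb⟩
    refine ⟨q, ⟨?_, ?_⟩, rfl⟩
    · rintro rfl
      exact hxb rfl
    · rintro rfl
      exact (Metric.mem_ball.1 hx).ne rfl
  refine (h3.mul ((h1.mul h2).mono sdiff_subset)).congr fun x hx => ?_
  have h4 := hWa x hx.1
  have h5 : k (0, b) - k (0, a) ≠ 0 := sub_ne_zero.2 hab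
  simp only [hg]
  field_simp

theorem hasSqrtOn_sub_not_iff_of_chart {p : ℝ → ℂ} {c : Set ℂ} (hp : IsPeriodicParam p c)
    {k : ℝ × ℝ → ℂ} (hk : IsOpenEmbedding k) (hkc : ∀ q, k q ∈ c ↔ q.2 = 0) {a b : ℝ}
    (hab : a * b < 0) :
    ¬ (HasSqrtOn (fun x => x - k (0, a)) c ↔ HasSqrtOn (fun x => x - k (0, b)) c) := by
  wlog h : a < 0 generalizing a b
  · have hb : b < 0 := by
      by_contra hb
      exact absurd hab (not_lt.2 (mul_nonneg (not_lt.1 h) (not_lt.1 hb)))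
    exact fun hiff => this (mul_comm a b ▸ hab) hb hiff.symm
  have hb : 0 < b := pos_of_mul_neg_right hab h.le
  have hne : ∀ y : ℝ, y ≠ 0 → ∀ x ∈ c, x - k (0, y) ≠ 0 := fun y hy x hx h0 =>
    hy ((hkc (0, y)).1 (sub_eq_zero.1 h0 ▸ hx))
  have key := not_hasSqrtOn_div_of_chart hk hkc
    (hp.isPreconnected_diff_singleton ((hkc (0, 0)).2 rfl)) h hb
  intro hiff
  by_cases hs : HasSqrtOn (fun x => x - k (0, a)) c
  · exact key ((hiff.1 hs).div hs (hne a h.ne))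
  · exact key (hp.hasSqrtOn_div (by fun_prop) (by fun_prop) (hne b hb.ne') (hne a h.ne)
      (fun h' => hs (hiff.2 h')) hs)

theorem IsPeriodicParam.exists_opposite_sides {p : ℝ → ℂ} {c : Set ℂ} (hp : IsPeriodicParam p c)
    {k : ℝ × ℝ → ℂ} (hk : IsOpenEmbedding k) (hkc : ∀ q, k q ∈ c ↔ q.1 = 0) {t : ℝ}
    (ht : p t = k (0, 0)) :
    ∃ δ > 0, ∀ u ∈ Ioo (t - δ) t, ∀ v ∈ Ioo t (t + δ),
      ∃ a b, a * b < 0 ∧ p u = k (0, a) ∧ p v = k (0, b) := by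
  have hV : p ⁻¹' range k ∈ 𝓝 t :=
    (hk.isOpen_range.preimage hp.continuous).mem_nhds ⟨_, ht.symm⟩
  obtain ⟨ε, hε, hεV⟩ := Metric.mem_nhds_iff.1 hV
  set δ := min (ε / 2) (1 / 4) with hδ
  have hδ0 : 0 < δ := by positivity
  have hδε : δ ≤ ε / 2 := min_le_left _ _
  have hδ1 : δ ≤ 1 / 4 := min_le_right _ _
  let e := hk.toOpenPartialHomeomorph k
  have he : ∀ q, e.symm (k q) = q := fun q => e.left_inv (mem_univ q)
  have hmaps : ∀ u ∈ Icc (t - δ) (t + δ), p u ∈ range k := fun u hu => hεV <| by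
    rw [Metric.mem_ball, Real.dist_eq, abs_lt]
    constructor <;> linarith [hu.1, hu.2]
  let y : ℝ → ℝ := fun u => (e.symm (p u)).2
  have hy : ∀ u ∈ Icc (t - δ) (t + δ), p u = k (0, y u) := by
    intro u hu
    obtain ⟨⟨a, b⟩, hq⟩ := hmaps u hu
    have ha : a = 0 := (hkc (a, b)).1 (hq ▸ hp.mem u)
    simp only [y, ← hq, he, ha]
  have hyc : ContinuousOn y (Icc (t - δ) (t + δ)) := by
    refine continuous_snd.comp_continuousOn ?_
    refine (e.continuousOn_symm.mono (?_ : range k ⊆ e.target)).comp hp.continuous.continuousOn hmaps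
    rintro _ ⟨q, rfl⟩
    exact e.map_source (mem_univ q)
  have hyi : InjOn y (Icc (t - δ) (t + δ)) := by
    intro u hu v hv huv
    refine hp.eq_of_abs_sub_lt_one (by rw [hy u hu, hy v hv, huv]) ?_
    rw [abs_lt]
    constructor <;> linarith [hu.1, hu.2, hv.1, hv.2]
  have htm : t ∈ Icc (t - δ) (t + δ) := ⟨by linarith, by linarith⟩
  have hyt : y t = 0 := by
    simp only [y, ht, he]
  refine ⟨δ, hδ0, fun u hu v hv => ?_⟩
  have hum : u ∈ Icc (t - δ) (t + δ) := ⟨hu.1.le, by linarith [hu.2]⟩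
  have hvm : v ∈ Icc (t - δ) (t + δ) := ⟨by linarith [hv.1], hv.2.le⟩
  refine ⟨y u, y v, ?_, hy u hum, hy v hvm⟩
  rcases hyc.strictMonoOn_of_injOn_Icc' (by linarith) hyi with hm | hm
  · exact mul_neg_of_neg_of_pos (hyt ▸ hm hum htm hu.2) (hyt ▸ hm htm hvm hv.1)
  · exact mul_neg_of_pos_of_neg (hyt ▸ hm hum htm hu.2) (hyt ▸ hm htm hvm hv.1)

/-- A two-valued function on `[0, 1]` that is locally constant except at the points of a finite
set `F`, where it changes, has equal values at the ends only if `F` has an even number of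
elements. -/
theorem even_card_of_flips {F : Finset ℝ} (hF : ∀ t ∈ F, 0 < t ∧ t < 1) {s : ℝ → Prop}
    (hs : ∀ t ∈ Icc (0 : ℝ) 1, t ∉ F → ∀ᶠ u in 𝓝 t, (s u ↔ s t))
    (hflip : ∀ t ∈ F, ∃ δ > 0, ∀ u ∈ Ioo (t - δ) t, ∀ v ∈ Ioo t (t + δ), ¬ (s u ↔ s v))
    (h01 : s 0 ↔ s 1) : Even F.card := by
  classical
  let N : ℝ → ℕ := fun t => (F.filter (· < t)).card
  let G : ℝ → Prop := fun t => Even (N t) ↔ (s t ↔ s 0)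
  have hnear : ∀ t : ℝ, ∃ δ > 0, ∀ u ∈ Ioo (t - δ) (t + δ), u ∈ F → u = t := by
    intro t
    have : ((F.erase t : Finset ℝ) : Set ℝ)ᶜ ∈ 𝓝 t :=
      (F.erase t).finite_toSet.isClosed.isOpen_compl.mem_nhds (by simp)
    obtain ⟨δ, hδ, h⟩ := Metric.mem_nhds_iff.1 this
    refine ⟨δ, hδ, fun u hu huF => ?_⟩
    by_contra hut
    rw [← Real.ball_eq_Ioo] at hu
    exact h hu (by simp [huF, hut])
  have hN1 : ∀ t δ u, (∀ u ∈ Ioo (t - δ) (t + δ), u ∈ F → u = t) → 0 < δ →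
      u ∈ Ioo (t - δ) (t + δ) → (u ≤ t ∨ t ∉ F) → N u = N t := by
    intro t δ u hδ hδ0 hu hut
    simp only [N]
    congr 1
    refine Finset.filter_congr fun x hx => ⟨fun h => ?_, fun h => ?_⟩
    · by_contra hxt
      have : x = t := hδ x ⟨by linarith, by linarith [hu.2]⟩ hx
      subst this
      rcases hut with hut | hut
      · linarith
      · exact hut hx
    · by_contra hxu
      have : x = t := hδ x ⟨by linarith [hu.1], by linarith⟩ hx
      linarith
  have hN2 : ∀ t δ u, (∀ u ∈ Ioo (t - δ) (t + δ), u ∈ F → u = t) →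
      u ∈ Ioo (t - δ) (t + δ) → t < u → t ∈ F → N u = N t + 1 := by
    intro t δ u hδ hu hut ht
    have : F.filter (· < u) = insert t (F.filter (· < t)) := by
      ext x
      simp only [Finset.mem_filter, Finset.mem_insert]
      constructor
      · rintro ⟨hx, hxu⟩
        by_cases hxt : x < t
        · exact Or.inr ⟨hx, hxt⟩
        · exact Or.inl (hδ x ⟨by linarith [hu.1, hu.2], by linarith [hu.2]⟩ hx)
      · rintro (rfl | ⟨hx, hxt⟩)
        · exact ⟨ht, hut⟩
        · exact ⟨hx, hxt.trans hut⟩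
    simp only [N, this]
    rw [Finset.card_insert_of_notMem (by simp)]
  have hdich : ∀ t ∈ Icc (0 : ℝ) 1, (∀ᶠ u in 𝓝 t, u ∉ F → G u) ∨ (∀ᶠ u in 𝓝 t, u ∉ F → ¬ G u) := by
    intro t htI
    obtain ⟨δ, hδ0, hδ⟩ := hnear t
    by_cases ht : t ∈ F
    · obtain ⟨δ', hδ0', hδ'⟩ := hflip t ht
      set η := min δ δ' with hη
      have hη0 : 0 < η := lt_min hδ0 hδ0'
      have hηδ : η ≤ δ := min_le_left _ _
      have hηδ' : η ≤ δ' := min_le_right _ _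
      have hopp : ∀ u ∈ Ioo (t - η) t, ∀ v ∈ Ioo t (t + η), (G u ↔ G v) := by
        intro u hu v hv
        have h1 := hN1 t δ u hδ hδ0 ⟨by linarith [hu.1], by linarith [hu.2]⟩ (Or.inl hu.2.le)
        have h2 := hN2 t δ v hδ ⟨by linarith [hv.1], by linarith [hv.2]⟩ hv.1 ht
        have h3 := hδ' u ⟨by linarith [hu.1], hu.2⟩ v ⟨hv.1, by linarith [hv.2]⟩
        simp only [G, h1, h2, Nat.even_add_one]
        tauto
      have hu0 : t - η / 2 ∈ Ioo (t - η) t := ⟨by linarith, by linarith⟩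
      have hv0 : t + η / 2 ∈ Ioo t (t + η) := ⟨by linarith, by linarith⟩
      have hall : ∀ u ∈ Ioo (t - η) (t + η), u ∉ F → (G u ↔ G (t - η / 2)) := by
        intro u hu huF
        rcases lt_trichotomy u t with h | h | h
        · rw [hopp _ hu0 _ hv0, hopp u ⟨hu.1, h⟩ _ hv0]
        · exact absurd (h ▸ ht) huF
        · rw [hopp _ hu0 u ⟨h, hu.2⟩]
      have hnhds : Ioo (t - η) (t + η) ∈ 𝓝 t := Ioo_mem_nhds (by linarith) (by linarith)
      by_cases hG : G (t - η / 2)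
      · exact Or.inl (by filter_upwards [hnhds] with u hu huF using (hall u hu huF).2 hG)
      · exact Or.inr (by filter_upwards [hnhds] with u hu huF h using hG ((hall u hu huF).1 h))
    · have hev : ∀ᶠ u in 𝓝 t, (G u ↔ G t) := by
        filter_upwards [hs t htI ht, Ioo_mem_nhds (show t - δ < t by linarith)
          (show t < t + δ by linarith)] with u hu huδ
        simp only [G, hu, hN1 t δ u hδ hδ0 huδ (Or.inr ht)]
      by_cases hG : G t
      · exact Or.inl (hev.mono fun u hu _ => hu.2 hG)
      · exact Or.inr (hev.mono fun u hu _ h => hG (hu.1 h))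
  have hN0 : N 0 = 0 := by
    simp only [N, Finset.card_eq_zero, Finset.filter_eq_empty_iff]
    exact fun x hx => not_lt.2 (hF x hx).1.le
  have hNone : N 1 = F.card := by
    simp only [N]
    rw [Finset.filter_true_of_mem fun x hx => (hF x hx).2]
  have h0F : (0 : ℝ) ∉ F := fun h => (hF 0 h).1.false
  have h1F : (1 : ℝ) ∉ F := fun h => (hF 1 h).2.false
  have hG0 : G 0 := by simp [G, hN0]
  have hsub : Icc (0 : ℝ) 1 ⊆ {t | ∀ᶠ u in 𝓝 t, u ∉ F → G u} := by
    refine isPreconnected_Icc.subset_left_of_subset_union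
      (v := {t | ∀ᶠ u in 𝓝 t, u ∉ F → ¬ G u}) isOpen_setOfPred_eventually_nhds
      isOpen_setOfPred_eventually_nhds ?_ hdich ⟨0, by simp, ?_⟩
    · rw [Set.disjoint_left]
      intro t h1 h2
      have h3 : Dense ((F : Set ℝ)ᶜ) := F.finite_toSet.countable.dense_compl ℝ
      obtain ⟨u, huF, hu1, hu2⟩ := h3.inter_nhds_nonempty (h1.and h2)
      exact hu2 huF (hu1 huF)
    · rcases hdich 0 (by simp) with h | h
      · exact h
      · exact absurd hG0 (h.self_of_nhds h0F)
  have hG1 : G 1 := (hsub (right_mem_Icc.2 zero_le_one)).self_of_nhds h1F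
  simp only [G, hNone, h01] at hG1
  exact hG1.2 trivial

/-- Closed curves in `ℂ` meeting only in crossings meet in an even number of points. -/
theorem finite_and_even_of_charts {p q : ℝ → ℂ} {b r : Set ℂ} (hp : IsPeriodicParam p b)
    (hq : IsPeriodicParam q r)
    (hcr : ∀ z ∈ b ∩ r, ∃ k : ℝ × ℝ → ℂ, IsOpenEmbedding k ∧ k (0, 0) = z ∧
      (∀ x, k x ∈ b ↔ x.2 = 0) ∧ (∀ x, k x ∈ r ↔ x.1 = 0)) :
    (b ∩ r).Finite ∧ Even (b ∩ r).ncard := by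
  have hfin : (b ∩ r).Finite := by
    refine (hp.isCompact.inter hq.isCompact).finite
      (isDiscrete_iff_forall_mem_exists_isOpen.2 fun z hz => ?_)
    obtain ⟨k, hk, rfl, hkb, hkr⟩ := hcr z hz
    refine ⟨range k, hk.isOpen_range, subset_antisymm ?_ ?_⟩
    · rintro _ ⟨⟨⟨u, v⟩, rfl⟩, h1, h2⟩
      have hv : v = 0 := (hkb _).1 h1
      have hu : u = 0 := (hkr _).1 h2
      rw [hu, hv]
      rfl
    · rintro _ rfl
      exact ⟨mem_range_self _, hz⟩
  refine ⟨hfin, ?_⟩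
  rcases (b ∩ r).eq_empty_or_nonempty with hemp | ⟨z, hz⟩
  · simp [hemp]
  obtain ⟨t₀, ht₀⟩ : ∃ t₀, q t₀ ∉ b := by
    obtain ⟨k, hk, -, hkb, hkr⟩ := hcr z hz
    obtain ⟨t₀, -, ht₀⟩ := hq.exists_mem_Ico 0 ((hkr (0, 1)).2 rfl)
    exact ⟨t₀, fun h => one_ne_zero ((hkb (0, 1)).1 (ht₀ ▸ h))⟩
  obtain ⟨q, hq, hq0⟩ : ∃ q, IsPeriodicParam q r ∧ q 0 ∉ b :=
    ⟨_, hq.translate t₀, by simpa using ht₀⟩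
  have hinj : InjOn q (Ico 0 1) := by simpa using hq.injOn_Ico 0
  set T : Set ℝ := {t | t ∈ Ico (0 : ℝ) 1 ∧ q t ∈ b} with hT
  have hTI : T ⊆ Ico 0 1 := fun t ht => ht.1
  have himg : q '' T = b ∩ r := by
    apply subset_antisymm
    · rintro _ ⟨t, ht, rfl⟩
      exact ⟨ht.2, hq.mem t⟩
    · rintro x ⟨hxb, hxr⟩
      obtain ⟨t, ht, rfl⟩ := hq.exists_mem_Ico 0 hxr
      exact ⟨t, ⟨by simpa using ht, hxb⟩, rfl⟩
  have hTfin : T.Finite := Finite.of_finite_image (himg ▸ hfin) (hinj.mono hTI)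
  rw [← himg, (hinj.mono hTI).ncard_image, ncard_eq_toFinset_card T hTfin]
  refine even_card_of_flips (s := fun t => HasSqrtOn (fun x => x - q t) b) ?_ ?_ ?_ ?_
  · intro t ht
    rw [hTfin.mem_toFinset] at ht
    exact ⟨ht.1.1.lt_of_ne fun h => hq0 (h ▸ ht.2), ht.1.2⟩
  · intro t htI ht
    rw [hTfin.mem_toFinset] at ht
    refine hq.continuous.continuousAt.eventually
      (eventually_hasSqrtOn_sub_iff hp.isCompact.isClosed fun htb => ?_)
    rcases htI.2.eq_or_lt with rfl | h1
    · exact hq0 (hq.map_one ▸ htb)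
    · exact ht ⟨⟨htI.1, h1⟩, htb⟩
  · intro t ht
    rw [hTfin.mem_toFinset] at ht
    obtain ⟨k, hk, hkt, hkb, hkr⟩ := hcr (q t) ⟨ht.2, hq.mem t⟩
    obtain ⟨δ, hδ, h⟩ := hq.exists_opposite_sides hk hkr hkt.symm
    refine ⟨δ, hδ, fun u hu v hv => ?_⟩
    obtain ⟨y, y', hy, hqu, hqv⟩ := h u hu v hv
    simp only [hqu, hqv]
    exact hasSqrtOn_sub_not_iff_of_chart hp hk hkb hy
  · simp only [hq.map_one]

theorem IsSimpleClosedCurve.exists_isPeriodicParam {c : Set (ℝ × ℝ)}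
    (hc : IsSimpleClosedCurve c) :
    ∃ p, IsPeriodicParam p (Complex.equivRealProdCLM.symm '' c) := by
  obtain ⟨f⟩ := hc
  let φ : ℝ → Metric.sphere (0 : EuclideanSpace ℝ (Fin 2)) 1 := fun t =>
    ⟨Complex.orthonormalBasisOneI.repr (Circle.exp (2 * Real.pi * t) : ℂ), by
      rw [mem_sphere_zero_iff_norm, LinearIsometryEquiv.norm_map, Circle.norm_coe]⟩
  have hφ : Continuous φ := by
    refine Continuous.subtype_mk ?_ _
    exact Complex.orthonormalBasisOneI.repr.continuous.comp (by fun_prop)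
  have hφs : Function.Surjective φ := by
    rintro ⟨x, hx⟩
    have hz : Complex.orthonormalBasisOneI.repr.symm x ∈ Submonoid.unitSphere ℂ :=
      mem_sphere_zero_iff_norm.2
        ((LinearIsometryEquiv.norm_map _ _).trans (mem_sphere_zero_iff_norm.1 hx))
    let z : Circle := ⟨_, hz⟩
    refine ⟨Complex.arg z / (2 * Real.pi), Subtype.ext ?_⟩
    change Complex.orthonormalBasisOneI.repr
      (Circle.exp (2 * Real.pi * (Complex.arg z / (2 * Real.pi))) : ℂ) = x
    rw [mul_div_cancel₀ _ (by positivity), Circle.exp_arg]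
    exact LinearIsometryEquiv.apply_symm_apply _ _
  have hφi : ∀ s t, φ s = φ t ↔ ∃ n : ℤ, t = s + n := by
    intro s t
    have h2π : 2 * Real.pi ≠ 0 := by positivity
    rw [Subtype.ext_iff, Complex.orthonormalBasisOneI.repr.injective.eq_iff,
      Circle.coe_inj, eq_comm, Circle.exp_eq_exp]
    refine exists_congr fun n => ?_
    rw [mul_comm (n : ℝ), ← mul_add, mul_right_inj' h2π]
  refine ⟨fun t => Complex.equivRealProdCLM.symm (f.symm (φ t)), ?_, ?_, fun s t => ?_⟩
  · exact Complex.equivRealProdCLM.symm.continuous.comp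
      (continuous_subtype_val.comp (f.symm.continuous.comp hφ))
  · rw [← Function.comp_def Complex.equivRealProdCLM.symm, range_comp]
    congr 1
    have hr : range (fun t => f.symm (φ t)) = univ := (f.symm.surjective.comp hφs).range_eq
    rw [← Function.comp_def Subtype.val, range_comp, hr, image_univ, Subtype.range_coe]
  · rw [Complex.equivRealProdCLM.symm.injective.eq_iff, Subtype.coe_inj,
      f.symm.injective.eq_iff, hφi]

theorem IsCrossing.exists_chart {β ρ : Set (ℝ × ℝ)} {z : ℝ × ℝ} (hz : IsCrossing β ρ z) :
    ∃ k : ℝ × ℝ → ℂ, IsOpenEmbedding k ∧ k (0, 0) = Complex.equivRealProdCLM.symm z ∧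
      (∀ x, k x ∈ Complex.equivRealProdCLM.symm '' β ↔ x.2 = 0) ∧
      (∀ x, k x ∈ Complex.equivRealProdCLM.symm '' ρ ↔ x.1 = 0) := by
  obtain ⟨U, hU, hzU, h, h0, hβ, hρ⟩ := hz
  have hmem : ∀ (c : Set (ℝ × ℝ)) (x : ℝ × ℝ),
      Complex.equivRealProdCLM.symm (h.symm x) ∈ Complex.equivRealProdCLM.symm '' c ↔
        x ∈ h '' {p : U | (p : ℝ × ℝ) ∈ c} := by
    intro c x
    rw [Complex.equivRealProdCLM.symm.injective.mem_set_image]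
    constructor
    · exact fun hx => ⟨h.symm x, hx, h.apply_symm_apply x⟩
    · rintro ⟨p, hp, rfl⟩
      rwa [h.symm_apply_apply]
  refine ⟨fun x => Complex.equivRealProdCLM.symm (h.symm x), ?_, ?_, fun x => ?_, fun x => ?_⟩
  · exact Complex.equivRealProdCLM.symm.toHomeomorph.isOpenEmbedding.comp
      (hU.isOpenEmbedding_subtypeVal.comp h.symm.isOpenEmbedding)
  · simp only [← h0, h.symm_apply_apply]
  · rw [hmem, hβ]
    rfl
  · rw [hmem, hρ]
    rfl

/-- If every intersection point of two simple closed curves is a crossing, then the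
intersection is a finite set of even cardinality. -/
theorem inter_finite_and_even_of_crossings
    (β ρ : Set (ℝ × ℝ))
    (hβ : IsSimpleClosedCurve β) (hρ : IsSimpleClosedCurve ρ)
    (hcr : ∀ z ∈ β ∩ ρ, IsCrossing β ρ z) :
    (β ∩ ρ).Finite ∧ Even (β ∩ ρ).ncard := by
  obtain ⟨p, hp⟩ := hβ.exists_isPeriodicParam
  obtain ⟨q, hq⟩ := hρ.exists_isPeriodicParam
  have hinj := Complex.equivRealProdCLM.symm.injective
  have key := finite_and_even_of_charts hp hq fun z hz => by
    rw [← image_inter hinj] at hz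
    obtain ⟨w, hw, rfl⟩ := hz
    exact (hcr w hw).exists_chart
  rw [← image_inter hinj, ncard_image_of_injective _ hinj] at key
  exact ⟨key.1.of_finite_image hinj.injOn, key.2⟩
end

section
/- Let β and ρ be simple closed curves in ℝ² such that every point of β ∩ ρ is either a crossing of β and ρ or a tangential intersection of β and ρ. Then β ∩ ρ is finite and the number of points of β ∩ ρ that are crossings is even. -/
namespace PlanarWinding

open Set Filter Topology

/-- The 1-periodic map `f` lifts through `Complex.exp`, and the lift increases by `2πin` over a
period: `n` is the winding number of `f` around `0`. -/
def HasWinding (f : ℝ → ℂ) (n : ℤ) : Prop :=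
  ∃ L : ℝ → ℂ, Continuous L ∧ (∀ t, Complex.exp (L t) = f t) ∧
    ∀ t, L (t + 1) = L t + n * (2 * Real.pi * Complex.I)

lemma exists_continuous_log {X : Type*} [TopologicalSpace X] [SimplyConnectedSpace X]
    [LocallyPathConnectedSpace X] {f : X → ℂ} (hf : Continuous f) (h0 : ∀ x, f x ≠ 0) :
    ∃ L : X → ℂ, Continuous L ∧ ∀ x, Complex.exp (L x) = f x := by
  obtain ⟨x₀⟩ : Nonempty X := inferInstance
  obtain ⟨F, ⟨-, hF⟩, -⟩ := Complex.isCoveringMapOn_exp.existsUnique_continuousMap_lifts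
    (⟨f, hf⟩ : C(X, ℂ)) (a₀ := x₀) (e₀ := Complex.log (f x₀)) (Complex.exp_log (h0 x₀))
    (fun x => h0 x)
  exact ⟨F, F.continuous, fun x => congrFun hF x⟩

lemma eq_of_exp_eq_one {X : Type*} [TopologicalSpace X] {s : Set X} (hs : IsPreconnected s)
    {D : X → ℂ} (hD : ContinuousOn D s) (h1 : ∀ x ∈ s, Complex.exp (D x) = 1) {x y : X}
    (hx : x ∈ s) (hy : y ∈ s) : D x = D y := by
  have hn : ∀ x ∈ s, ∃ n : ℤ, D x = n * (2 * Real.pi * Complex.I) := fun x hx =>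
    Complex.exp_eq_one_iff.1 (h1 x hx)
  have hpi : (2 * Real.pi * Complex.I : ℂ) ≠ 0 := Complex.two_pi_I_ne_zero
  choose! n hn using hn
  have hcont : ContinuousOn n s := by
    have h2 : ContinuousOn (fun x => ((n x : ℝ))) s := by
      have h3 : ContinuousOn (fun x => (D x / (2 * Real.pi * Complex.I)).re) s :=
        Complex.continuous_re.comp_continuousOn (hD.div_const _)
      refine h3.congr fun x hx => ?_
      simp only [hn x hx]
      rw [mul_div_assoc, div_self hpi, mul_one, Complex.intCast_re]
    exact Int.isClosedEmbedding_coe_real.isEmbedding.continuousOn_iff.2 h2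
  have := hs.constant hcont hx hy
  rw [hn x hx, hn y hy, this]

lemma HasWinding.unique {f : ℝ → ℂ} {m n : ℤ} (hm : HasWinding f m) (hn : HasWinding f n) :
    m = n := by
  obtain ⟨L, hL, hLf, hLp⟩ := hm
  obtain ⟨M, hM, hMf, hMp⟩ := hn
  have h := eq_of_exp_eq_one isPreconnected_univ (D := fun t => L t - M t)
    (hL.sub hM).continuousOn (fun t _ => by
      rw [Complex.exp_sub, hLf, ← hMf, div_self (Complex.exp_ne_zero _)])
    (mem_univ (0 + 1 : ℝ)) (mem_univ 0)
  simp only [hLp, hMp] at h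
  have h2 : ((m : ℂ) - n) * (2 * Real.pi * Complex.I) = 0 := by linear_combination h
  rcases mul_eq_zero.1 h2 with h3 | h3
  · exact_mod_cast sub_eq_zero.1 h3
  · exact absurd h3 Complex.two_pi_I_ne_zero

lemma HasWinding.div {f g : ℝ → ℂ} {m n : ℤ} (hm : HasWinding f m) (hn : HasWinding g n) :
    HasWinding (fun t => f t / g t) (m - n) := by
  obtain ⟨L, hL, hLf, hLp⟩ := hm
  obtain ⟨M, hM, hMf, hMp⟩ := hn
  refine ⟨fun t => L t - M t, hL.sub hM, fun t => by rw [Complex.exp_sub, hLf, hMf], fun t => ?_⟩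
  simp only [hLp, hMp]
  push_cast
  ring

/-- A homotopy of 1-periodic nonvanishing maps has a constant winding number. -/
lemma exists_hasWinding_homotopy {F : ℝ → ℝ → ℂ} (hF : Continuous fun p : ℝ × ℝ => F p.1 p.2)
    (h0 : ∀ s ∈ Icc (0 : ℝ) 1, ∀ t, F s t ≠ 0) (hper : ∀ s t, F s (t + 1) = F s t) :
    ∃ n, ∀ s ∈ Icc (0 : ℝ) 1, HasWinding (F s) n := by
  have hc : Continuous fun s : ℝ => ((projIcc (0 : ℝ) 1 zero_le_one s : Icc (0 : ℝ) 1) : ℝ) :=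
    continuous_subtype_val.comp continuous_projIcc
  obtain ⟨L, hL, hLF⟩ := exists_continuous_log
    (f := fun p : ℝ × ℝ => F (projIcc (0 : ℝ) 1 zero_le_one p.1) p.2)
    (hF.comp ((hc.comp continuous_fst).prodMk continuous_snd))
    (fun p => h0 _ (Subtype.coe_prop _) _)
  have hD : ∀ p q : ℝ × ℝ, L (p.1, p.2 + 1) - L p = L (q.1, q.2 + 1) - L q := fun p q =>
    eq_of_exp_eq_one isPreconnected_univ
      (D := fun p : ℝ × ℝ => L (p.1, p.2 + 1) - L p)
      (by fun_prop) (fun p _ => by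
        rw [Complex.exp_sub, hLF, hLF, hper]
        exact div_self (h0 _ (Subtype.coe_prop _) _)) (mem_univ p) (mem_univ q)
  obtain ⟨n, hn⟩ : ∃ n : ℤ, L (0, 0 + 1) - L (0, 0) = n * (2 * Real.pi * Complex.I) := by
    rw [← Complex.exp_eq_one_iff, Complex.exp_sub, hLF, hLF, hper]
    exact div_self (h0 _ (Subtype.coe_prop _) _)
  refine ⟨n, fun s hs => ⟨fun t => L (s, t), by fun_prop, fun t => ?_, fun t => ?_⟩⟩
  · rw [hLF]; simp only [projIcc_of_mem zero_le_one hs]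
  · rw [← hn, ← hD (s, t) (0, 0)]; ring

lemma exists_hasWinding {f : ℝ → ℂ} (hf : Continuous f) (h0 : ∀ t, f t ≠ 0)
    (hper : ∀ t, f (t + 1) = f t) : ∃ n, HasWinding f n :=
  let ⟨n, hn⟩ := exists_hasWinding_homotopy (F := fun _ t => f t) (by fun_prop)
    (fun _ _ => h0) (fun _ => hper)
  ⟨n, hn 0 (by simp)⟩

lemma HasWinding.homotopy {F : ℝ → ℝ → ℂ} (hF : Continuous fun p : ℝ × ℝ => F p.1 p.2)
    (h0 : ∀ s ∈ Icc (0 : ℝ) 1, ∀ t, F s t ≠ 0) (hper : ∀ s t, F s (t + 1) = F s t) {n : ℤ}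
    (hn : HasWinding (F 0) n) : HasWinding (F 1) n := by
  obtain ⟨m, hm⟩ := exists_hasWinding_homotopy hF h0 hper
  rw [hn.unique (hm 0 (by simp))]
  exact hm 1 (by simp)

lemma add_int_of_add_one {L : ℝ → ℂ} {c : ℂ} (h : ∀ t, L (t + 1) = L t + c) (t : ℝ) (n : ℤ) :
    L (t + n) = L t + n * c := by
  induction n using Int.induction_on with
  | zero => simp
  | succ k ih =>
    push_cast at ih ⊢
    rw [← add_assoc, h, ih]; ring
  | pred k ih =>
    push_cast at ih ⊢
    have := h (t + (-k - 1))
    rw [show t + (-(k : ℝ) - 1) + 1 = t + -k by ring, ih] at this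
    linear_combination -this

lemma exp_two_pi_add_one (t : ℝ) : Complex.exp (2 * Real.pi * Complex.I * ((t + 1 : ℝ) : ℂ)) =
    Complex.exp (2 * Real.pi * Complex.I * t) := by
  push_cast
  rw [mul_add, mul_one, Complex.exp_add, Complex.exp_two_pi_mul_I, mul_one]

/-- An open embedding of the plane in itself has local degree `±1`. -/
lemma isUnit_winding_of_isOpenEmbedding {k : ℂ → ℂ} (hk : IsOpenEmbedding k) {d : ℤ}
    (hd : HasWinding (fun t => k (Complex.exp (2 * Real.pi * Complex.I * t)) - k 0) d) :
    IsUnit d := by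
  obtain ⟨ε, hε, hball⟩ := Metric.isOpen_iff.1 hk.isOpen_range (k 0) (mem_range_self 0)
  set c : ℝ → ℂ := fun t => (ε / 2 : ℝ) * Complex.exp (2 * Real.pi * Complex.I * t) with hc
  have hnorm : ∀ t, ‖c t‖ = ε / 2 := fun t => by
    rw [hc]
    simp only [norm_mul, Complex.norm_real, Complex.norm_exp]
    simp [abs_of_pos hε]
  have hcc : Continuous c := by fun_prop
  have hmem : ∀ t, k 0 + c t ∈ range k := fun t => hball (by
    rw [Metric.mem_ball, dist_eq_norm, add_sub_cancel_left, hnorm]; linarith)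
  choose g hg using hmem
  have hgc : Continuous g := by
    rw [hk.isEmbedding.continuous_iff]
    exact (continuous_const.add hcc).congr fun t => (hg t).symm
  have hcper : ∀ t, c (t + 1) = c t := fun t => by simp only [hc, exp_two_pi_add_one]
  have hgper : ∀ t, g (t + 1) = g t := fun t => hk.injective (by rw [hg, hg, hcper])
  have hg0 : ∀ t, g t ≠ 0 := fun t h => by
    have := hg t
    rw [h, left_eq_add, ← norm_eq_zero, hnorm] at this
    linarith
  obtain ⟨n, M, hM, hMg, hMp⟩ := exists_hasWinding hgc hg0 hgper
  have hkc := hk.continuous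
  have h1 : HasWinding (fun t => k (Complex.exp ((1 - ((0 : ℝ) : ℂ)) * M t +
      ((0 : ℝ) : ℂ) * (2 * Real.pi * Complex.I * n * t))) - k 0) 1 := by
    refine ⟨fun t => Real.log (ε / 2) + 2 * Real.pi * Complex.I * t, by fun_prop,
      fun t => ?_, fun t => ?_⟩
    · simp only [Complex.ofReal_zero, sub_zero, one_mul, zero_mul, add_zero, hMg, hg,
        add_sub_cancel_left]
      rw [Complex.exp_add, ← Complex.ofReal_exp, Real.exp_log (by positivity)]
    · push_cast; ring
  have h2 := HasWinding.homotopy (F := fun s t => k (Complex.exp ((1 - (s : ℂ)) * M t +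
      (s : ℂ) * (2 * Real.pi * Complex.I * n * t))) - k 0) (by fun_prop)
      (fun s _ t h => Complex.exp_ne_zero _ (hk.injective (sub_eq_zero.1 h))) (fun s t => by
        congr 2
        rw [hMp, Complex.exp_eq_exp_iff_exists_int]
        exact ⟨n, by push_cast; ring⟩) h1
  obtain ⟨L, hL, hLf, hLp⟩ := hd
  have h3 : HasWinding (fun t => k (Complex.exp ((1 - ((1 : ℝ) : ℂ)) * M t +
      ((1 : ℝ) : ℂ) * (2 * Real.pi * Complex.I * n * t))) - k 0) (n * d) := by
    refine ⟨fun t => L (n * t), by fun_prop, fun t => ?_, fun t => ?_⟩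
    · rw [hLf]
      push_cast; ring_nf
    · beta_reduce
      rw [mul_add, mul_one, add_int_of_add_one hLp]
      push_cast; ring
  exact IsUnit.of_mul_eq_one_right n (h3.unique h2)

/-- `b` parametrizes a simple closed curve as `ℝ / ℤ`, and curves in its range lift to `ℝ`. -/
structure IsClosedParam (b : ℝ → ℂ) : Prop where
  continuous : Continuous b
  eq_iff : ∀ s t, b s = b t ↔ ∃ m : ℤ, s = t + m
  exists_lift : ∀ f : ℝ → ℂ, Continuous f → (∀ x, f x ∈ range b) →
    ∃ τ : ℝ → ℝ, Continuous τ ∧ ∀ x, b (τ x) = f x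

lemma IsClosedParam.add_int {b : ℝ → ℂ} (hb : IsClosedParam b) (t : ℝ) (m : ℤ) :
    b (t + m) = b t := (hb.eq_iff _ _).2 ⟨m, rfl⟩

lemma IsClosedParam.add_one {b : ℝ → ℂ} (hb : IsClosedParam b) (t : ℝ) :
    b (t + 1) = b t := by simpa using hb.add_int t 1

lemma IsClosedParam.isCompact_range {b : ℝ → ℂ} (hb : IsClosedParam b) : IsCompact (range b) := by
  have : range b = b '' Icc 0 1 := by
    refine Subset.antisymm ?_ (image_subset_range _ _)
    rintro _ ⟨t, rfl⟩
    refine ⟨Int.fract t, ⟨Int.fract_nonneg t, (Int.fract_lt_one t).le⟩, ?_⟩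
    rw [← hb.add_int (Int.fract t) ⌊t⌋, Int.fract_add_floor]
  rw [this]
  exact isCompact_Icc.image hb.continuous

/-- If `τ` lifts an injective curve, values of `τ` never differ by a nonzero integer, so the
oscillation of `τ` is at most `1`. -/
lemma IsClosedParam.lt_add_one {b : ℝ → ℂ} (hb : IsClosedParam b) {τ : ℝ → ℝ}
    (hτ : Continuous τ) (hinj : Function.Injective fun x => b (τ x)) (x y : ℝ) :
    τ x < τ y + 1 := by
  by_contra! h
  obtain ⟨z, -, hz⟩ := isPreconnected_univ.intermediate_value (mem_univ y) (mem_univ x)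
    hτ.continuousOn ⟨(by linarith : τ y ≤ τ y + 1), h⟩
  have h1 : z = y := hinj (by simp only [hz, hb.add_one])
  rw [h1] at hz
  linarith

lemma log_sub_log_eq_of_eq_one {M f : ℝ → ℂ} {N : ℤ} (hM : Continuous M)
    (hMf : ∀ t, Complex.exp (M t) = f t)
    (hMp : ∀ t, M (t + 1) = M t + N * (2 * Real.pi * Complex.I)) {u v : ℝ}
    (h1 : ∀ t ∈ Ioo v (u + 1), f t = 1) (huv : v < u + 1) :
    M v - M u = N * (2 * Real.pi * Complex.I) := by
  have hf : Continuous f := (Complex.continuous_exp.comp hM).congr hMf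
  have h2 : ∀ t ∈ Icc v (u + 1), f t = 1 := by
    rw [← closure_Ioo huv.ne]
    exact fun t ht => (isClosed_eq hf continuous_const).closure_subset_iff.2 h1 ht
  have := eq_of_exp_eq_one isPreconnected_Icc hM.continuousOn
    (fun t ht => by rw [hMf, h2 t ht]) (left_mem_Icc.2 huv.le) (right_mem_Icc.2 huv.le)
  rw [this, hMp]; ring

/-- The winding number of a closed curve changes by an odd number across an arc of the curve that
is flat in a chart (here straightened to the upper half of the unit circle). -/
lemma odd_winding_sub {b : ℝ → ℂ} (hb : IsClosedParam b) {k : ℂ → ℂ} (hk : IsOpenEmbedding k)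
    (hkb : ∀ w, k w ∈ range b ↔ w.im = √(1 - w.re ^ 2)) {m n : ℤ}
    (hm : HasWinding (fun t => b t - k 0) m)
    (hn : HasWinding (fun t => b t - k (2 * Complex.I)) n) : Odd (m - n) := by
  classical
  have hbc := hb.continuous
  have hkc := hk.continuous
  -- the curve obtained from `b` by scaling the heights of the arc by a factor `s`
  obtain ⟨Φ, hΦr, hΦn⟩ : ∃ Φ : ℝ → ℝ → ℂ,
      (∀ s t w, b t = k w → Φ s t = k (w.re + s * √(1 - w.re ^ 2) * Complex.I)) ∧
      (∀ s t, b t ∉ range k → Φ s t = b t) := by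
    refine ⟨fun s t => if h : b t ∈ range k then
      k (h.choose.re + s * √(1 - h.choose.re ^ 2) * Complex.I) else b t, fun s t w hw => ?_,
      fun s t h => dif_neg h⟩
    have h : b t ∈ range k := ⟨w, hw.symm⟩
    have h2 : h.choose = w := hk.injective (h.choose_spec.trans hw)
    simp only [dif_pos h, h2]
  have hre : ∀ x y : ℝ, ((x : ℂ) + y * Complex.I).re = x := fun x y => by simp
  have him : ∀ x y : ℝ, ((x : ℂ) + y * Complex.I).im = y := fun x y => by simp
  have hfar : ∀ s t w, b t = k w → 1 ≤ w.re ^ 2 → Φ s t = b t := fun s t w hw h1 => by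
    have h2 : √(1 - w.re ^ 2) = 0 := Real.sqrt_eq_zero_of_nonpos (by linarith)
    have h3 := (hkb w).1 ⟨t, hw⟩
    rw [hΦr s t w hw, hw, h2]
    congr 1
    apply Complex.ext <;> simp [h3, h2]
  have hΦ1 : ∀ t, Φ 1 t = b t := fun t => by
    by_cases h : b t ∈ range k
    · obtain ⟨w, hw⟩ := h
      rw [hΦr 1 t w hw.symm, ← hw]
      congr 1
      apply Complex.ext <;> simp [(hkb w).1 ⟨t, hw.symm⟩]
    · exact hΦn 1 t h
  have hΦper : ∀ s t, Φ s (t + 1) = Φ s t := fun s t => by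
    by_cases h : b t ∈ range k
    · obtain ⟨w, hw⟩ := h
      rw [hΦr s t w hw.symm, hΦr s (t + 1) w (by rw [hb.add_one, hw])]
    · rw [hΦn s t h, hΦn s (t + 1) (by rwa [hb.add_one]), hb.add_one]
  have hΦc : Continuous fun p : ℝ × ℝ => Φ p.1 p.2 := by
    have hK : IsCompact (k '' {w : ℂ | w.im = √(1 - w.re ^ 2) ∧ w.re ∈ Icc (-1 : ℝ) 1}) := by
      have : {w : ℂ | w.im = √(1 - w.re ^ 2) ∧ w.re ∈ Icc (-1 : ℝ) 1} =
          (fun x : ℝ => (x : ℂ) + √(1 - x ^ 2) * Complex.I) '' Icc (-1) 1 := by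
        ext w
        constructor
        · rintro ⟨h1, h2⟩
          exact ⟨w.re, h2, by beta_reduce; rw [← h1, Complex.re_add_im]⟩
        · rintro ⟨x, hx, rfl⟩
          simpa only [mem_ofPred_eq, hre, him, true_and] using hx
      rw [this]
      exact (isCompact_Icc.image (by fun_prop)).image hkc
    rw [continuous_iff_continuousAt]
    rintro ⟨s, t⟩
    by_cases h : b t ∈ range k
    · have hopen : IsOpen ((fun p : ℝ × ℝ => b p.2) ⁻¹' range k) :=
        hk.isOpen_range.preimage (by fun_prop)
      have hev := hopen.mem_nhds (show (s, t) ∈ _ from h)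
      obtain ⟨w, hw⟩ := h
      let e := hk.toOpenPartialHomeomorph k
      have hleft : ∀ w, e.symm (k w) = w := fun w => e.left_inv (by simp [e])
      have hcont : ContinuousAt (fun p : ℝ × ℝ => e.symm (b p.2)) (s, t) := by
        refine ContinuousAt.comp (g := e.symm) (f := fun p : ℝ × ℝ => b p.2) ?_ (by fun_prop)
        refine e.symm.continuousAt ?_
        simp only [e, OpenPartialHomeomorph.symm_source]
        exact ⟨w, by simp, hw⟩
      have : (fun p : ℝ × ℝ => Φ p.1 p.2) =ᶠ[𝓝 (s, t)] fun p =>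
          k ((e.symm (b p.2)).re + p.1 * √(1 - (e.symm (b p.2)).re ^ 2) * Complex.I) := by
        filter_upwards [hev] with p hp
        obtain ⟨w', hw'⟩ := hp
        simp only at hw'
        rw [hΦr p.1 p.2 w' hw'.symm, ← hw', hleft]
      rw [continuousAt_congr this]
      fun_prop
    · have hev : ∀ᶠ p : ℝ × ℝ in 𝓝 (s, t),
          b p.2 ∉ k '' {w : ℂ | w.im = √(1 - w.re ^ 2) ∧ w.re ∈ Icc (-1 : ℝ) 1} :=
        (hK.isClosed.isOpen_compl.preimage (hbc.comp continuous_snd)).mem_nhds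
          (fun hmem => h (image_subset_range _ _ hmem))
      have : (fun p : ℝ × ℝ => Φ p.1 p.2) =ᶠ[𝓝 (s, t)] fun p => b p.2 := by
        filter_upwards [hev] with p hp
        by_cases h' : b p.2 ∈ range k
        · obtain ⟨w, hw⟩ := h'
          refine hfar _ _ w hw.symm ?_
          by_contra! h1
          exact hp ⟨w, ⟨(hkb w).1 ⟨_, hw.symm⟩, abs_le.1 ((sq_lt_one_iff_abs_lt_one _).1 h1).le⟩,
            hw⟩
        · exact hΦn _ _ h'
      rw [continuousAt_congr this]
      fun_prop
  have hfib : ∀ s t w, Φ s t = k w → w.im = s * √(1 - w.re ^ 2) := fun s t w hw => by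
    by_cases h : b t ∈ range k
    · obtain ⟨w', hw'⟩ := h
      rw [hΦr s t w' hw'.symm] at hw
      have h2 := hk.injective hw
      rw [← h2]
      simp
    · rw [hΦn s t h] at hw
      exact absurd ⟨w, hw.symm⟩ h
  have hne0 : ∀ t, Φ (-1) t - k 0 ≠ 0 := fun t h => by
    simpa using hfib _ _ _ (sub_eq_zero.1 h)
  have hn' : HasWinding (fun t => Φ (-1) t - k (2 * Complex.I)) n := by
    have := HasWinding.homotopy (F := fun s t => Φ (1 - 2 * s) t - k (2 * Complex.I)) (n := n)
      ((hΦc.comp (by fun_prop : Continuous fun p : ℝ × ℝ => (1 - 2 * p.1, p.2))).sub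
        continuous_const) (fun s hs t h => by
          have := hfib _ _ _ (sub_eq_zero.1 h)
          simp at this
          linarith [hs.1]) (fun s t => by simp only [hΦper])
        (by simpa only [mul_zero, sub_zero, hΦ1] using hn)
    simpa only [show (1 : ℝ) - 2 * 1 = -1 by norm_num] using this
  have hn'' : HasWinding (fun t => Φ (-1) t - k 0) n := by
    have := HasWinding.homotopy
      (F := fun s t => Φ (-1) t - k ((2 - 2 * s : ℝ) * Complex.I)) (n := n)
      ((hΦc.comp (by fun_prop : Continuous fun p : ℝ × ℝ => ((-1 : ℝ), p.2))).sub
        (by fun_prop)) (fun s hs t h => by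
          have := hfib _ _ _ (sub_eq_zero.1 h)
          simp at this
          linarith [hs.2]) (fun s t => by simp only [hΦper])
        (by simpa using hn')
    simpa using this
  obtain ⟨M, hM, hMQ, hMp⟩ := hm.div hn''
  have hφinj : Function.Injective fun x : ℝ => k (x + √(1 - x ^ 2) * Complex.I) := fun x y h => by
    simpa only [hre] using congrArg Complex.re (hk.injective h)
  obtain ⟨τ, hτ, hτb⟩ := hb.exists_lift (fun x : ℝ => k (x + √(1 - x ^ 2) * Complex.I))
    (by fun_prop) (fun x => by rw [hkb, hre, him])
  have hτb' : (fun x => b (τ x)) = fun x : ℝ => k (x + √(1 - x ^ 2) * Complex.I) := funext hτb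
  have hlt := hb.lt_add_one hτ (by rwa [hτb'])
  have hτinj : Function.Injective τ := fun x y h => hφinj (by simp only [← hτb, h])
  have hQ : ∀ t, (∀ x ∈ Icc (-1 : ℝ) 1, ∀ j : ℤ, t ≠ τ x + j) →
      (b t - k 0) / (Φ (-1) t - k 0) = 1 := fun t ht => by
    have hΦt : Φ (-1) t = b t := by
      by_cases h : b t ∈ range k
      · obtain ⟨w, hw⟩ := h
        refine hfar _ _ w hw.symm ?_
        by_contra! h1
        have h2 : b t = b (τ w.re) := by
          rw [hτb, ← (hkb w).1 ⟨t, hw.symm⟩, Complex.re_add_im, hw]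
        obtain ⟨j, hj⟩ := (hb.eq_iff _ _).1 h2
        exact ht w.re (abs_le.1 ((sq_lt_one_iff_abs_lt_one _).1 h1).le) j hj
      · exact hΦn _ _ h
    have := hne0 t
    rw [hΦt] at this ⊢
    exact div_self this
  have hend : ∀ u v : ℝ, (∀ x ∈ Icc (-1 : ℝ) 1, τ x ∈ Icc u v) → v < u + 1 →
      M v - M u = (m - n : ℤ) * (2 * Real.pi * Complex.I) := fun u v hx huv => by
    refine log_sub_log_eq_of_eq_one hM hMQ hMp (fun t ht => hQ t fun x hxI j hj => ?_) huv
    have h1 := hx x hxI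
    have h2 : (0 : ℝ) < j := by linarith [ht.1, h1.2]
    have h3 : (j : ℝ) < 1 := by linarith [ht.2, h1.1]
    norm_cast at h2 h3
    omega
  have hexp0 : ∀ t : ℝ, k (Complex.exp (2 * Real.pi * Complex.I * t)) - k 0 ≠ 0 := fun t h =>
    Complex.exp_ne_zero _ (hk.injective (sub_eq_zero.1 h))
  obtain ⟨d, hd⟩ := exists_hasWinding
    (f := fun t => k (Complex.exp (2 * Real.pi * Complex.I * t)) - k 0) (by fun_prop)
    hexp0 (fun t => by simp only [exp_two_pi_add_one])
  have hdu := isUnit_winding_of_isOpenEmbedding hk hd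
  obtain ⟨L, hL, hLf, hLp⟩ := hd
  have hexp : ∀ t : ℝ, Complex.exp (2 * Real.pi * Complex.I * t) =
      Real.cos (2 * Real.pi * t) + Real.sin (2 * Real.pi * t) * Complex.I := fun t => by
    rw [show 2 * Real.pi * Complex.I * t = ((2 * Real.pi * t : ℝ) : ℂ) * Complex.I by
      push_cast; ring, Complex.exp_mul_I, Complex.ofReal_cos, Complex.ofReal_sin]
  have hD := eq_of_exp_eq_one (isPreconnected_Icc (a := (0 : ℝ)) (b := 1 / 2))
    (D := fun u => M (τ (Real.cos (2 * Real.pi * u))) - (L u - L (-u)))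
    (by fun_prop) (fun u hu => by
      have hsin : 0 ≤ Real.sin (2 * Real.pi * u) := Real.sin_nonneg_of_nonneg_of_le_pi
        (by have := Real.pi_pos; have := hu.1; positivity) (by nlinarith [Real.pi_pos, hu.2])
      have hsq : √(1 - Real.cos (2 * Real.pi * u) ^ 2) = Real.sin (2 * Real.pi * u) := by
        rw [← Real.abs_sin_eq_sqrt_one_sub_cos_sq, abs_of_nonneg hsin]
      have hbτ := hτb (Real.cos (2 * Real.pi * u))
      rw [hsq] at hbτ
      have h1 := hexp (-u)
      rw [mul_neg, Real.cos_neg, Real.sin_neg, Complex.ofReal_neg (Real.sin _)] at h1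
      rw [Complex.exp_sub, Complex.exp_sub, hMQ, hLf, hLf]
      beta_reduce
      rw [hΦr _ _ _ hbτ, hbτ, hre, hsq, ← hexp, Complex.ofReal_neg, Complex.ofReal_one,
        neg_one_mul, ← h1]
      exact div_self (div_ne_zero (hexp0 _) (hexp0 _)))
    (left_mem_Icc.2 (by norm_num)) (right_mem_Icc.2 (by norm_num))
  have hLhalf : L (1 / 2) = L (-(1 / 2)) + d * (2 * Real.pi * Complex.I) := by
    rw [← hLp]; norm_num
  have hdiff : M (τ 1) - M (τ (-1)) = (-d : ℤ) * (2 * Real.pi * Complex.I) := by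
    rw [show 2 * Real.pi * (1 / 2) = Real.pi by ring, hLhalf] at hD
    simp only [mul_zero, Real.cos_zero, neg_zero, sub_self, sub_zero, Real.cos_pi] at hD
    rw [hD]; push_cast; ring
  have hdodd : Odd d := by
    rcases Int.isUnit_iff.1 hdu with h | h <;> rw [h] <;> decide
  have hpi := Complex.two_pi_I_ne_zero
  rcases hτ.strictMono_of_inj hτinj with hmono | hanti
  · have h1 := hend (τ (-1)) (τ 1) (fun x hx => ⟨hmono.monotone hx.1, hmono.monotone hx.2⟩)
      (hlt _ _)
    rw [hdiff] at h1
    have h2 : -d = m - n := by exact_mod_cast mul_right_cancel₀ hpi h1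
    rw [← h2]
    exact hdodd.neg
  · have h1 := hend (τ 1) (τ (-1)) (fun x hx => ⟨hanti.antitone hx.2, hanti.antitone hx.1⟩)
      (hlt _ _)
    rw [← neg_sub, hdiff] at h1
    have h2 : d = m - n := by
      have : ((d : ℤ) : ℂ) * (2 * Real.pi * Complex.I) =
          (m - n : ℤ) * (2 * Real.pi * Complex.I) := by rw [← h1]; push_cast; ring
      exact_mod_cast mul_right_cancel₀ hpi this
    rw [← h2]
    exact hdodd

/-- A function that is locally constant off a finite set `C` and jumps by one at each point of `C`
changes by the parity of the cardinality of `C`. -/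
lemma card_eq_sub_of_jumps {w : ℝ → ZMod 2} {a c : ℝ} (hac : a ≤ c) {C : Set ℝ} (hC : C.Finite)
    (hCs : C ⊆ Ioo a c) (h1 : ∀ t ∈ Icc a c, t ∉ C → ∃ v, ∀ᶠ s in 𝓝[≠] t, w s = v)
    (h2 : ∀ t ∈ C, ∃ v, (∀ᶠ s in 𝓝[<] t, w s = v) ∧ ∀ᶠ s in 𝓝[>] t, w s = v + 1)
    (ha : ∀ᶠ s in 𝓝 a, w s = w a) (hc : ∀ᶠ s in 𝓝 c, w s = w c) :
    w c = w a + (C.ncard : ZMod 2) := by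
  set N : ℝ → ZMod 2 := fun t => ((C ∩ Iio t).ncard : ZMod 2) with hN
  have hNl : ∀ t, ∀ᶠ s in 𝓝[<] t, N s = N t := fun t => by
    have h3 : ∀ᶠ s in 𝓝[<] t, ∀ x ∈ C ∩ Iio t, x < s :=
      ((hC.subset inter_subset_left).eventually_all).2 fun x hx =>
        mem_nhdsWithin_of_mem_nhds (lt_mem_nhds hx.2)
    filter_upwards [h3, self_mem_nhdsWithin] with s hs hst
    have : C ∩ Iio s = C ∩ Iio t := by
      ext x
      exact ⟨fun hx => ⟨hx.1, mem_Iio.2 (hx.2.trans hst)⟩, fun hx => ⟨hx.1, hs x hx⟩⟩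
    simp only [hN, this]
  have hNr : ∀ t, ∀ᶠ s in 𝓝[>] t, N s = ((C ∩ Iic t).ncard : ZMod 2) := fun t => by
    have h3 : ∀ᶠ s in 𝓝[>] t, ∀ x ∈ C ∩ Ioi t, s < x :=
      ((hC.subset inter_subset_left).eventually_all).2 fun x hx =>
        mem_nhdsWithin_of_mem_nhds (gt_mem_nhds hx.2)
    filter_upwards [h3, self_mem_nhdsWithin] with s hs hst
    have : C ∩ Iio s = C ∩ Iic t := by
      ext x
      refine ⟨fun hx => ⟨hx.1, ?_⟩, fun hx => ⟨hx.1, mem_Iio.2 (lt_of_le_of_lt hx.2 hst)⟩⟩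
      by_contra! h
      exact (hs x ⟨hx.1, mem_Ioi.2 (not_le.1 h)⟩).not_gt hx.2
    simp only [hN, this]
  have hNC : ∀ t ∈ C, ((C ∩ Iic t).ncard : ZMod 2) = N t + 1 := fun t ht => by
    have : C ∩ Iic t = insert t (C ∩ Iio t) := by
      ext x
      simp only [mem_inter_iff, mem_Iic, mem_insert_iff, mem_Iio, le_iff_lt_or_eq]
      constructor
      · rintro ⟨hx, h | h⟩
        exacts [Or.inr ⟨hx, h⟩, Or.inl h]
      · rintro (rfl | h)
        exacts [⟨ht, Or.inr rfl⟩, ⟨h.1, Or.inl h.2⟩]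
    rw [this, ncard_insert_of_notMem (by simp) (hC.subset inter_subset_left)]
    push_cast
    rfl
  have hNn : ∀ t, t ∉ C → ∀ᶠ s in 𝓝[≠] t, N s = N t := fun t ht => by
    have : C ∩ Iic t = C ∩ Iio t := by
      ext x
      refine ⟨fun hx => ⟨hx.1, mem_Iio.2 (lt_of_le_of_ne hx.2 ?_)⟩, fun hx => ⟨hx.1, mem_Iic.2 (le_of_lt hx.2)⟩⟩
      rintro rfl
      exact ht hx.1
    rw [← nhdsLT_sup_nhdsGT, eventually_sup]
    exact ⟨hNl t, by simpa only [this] using hNr t⟩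
  have hG : ∀ t ∈ Icc a c, ∃ v, ∀ᶠ s in 𝓝[≠] t, w s + N s = v := fun t ht => by
    by_cases htC : t ∈ C
    · obtain ⟨v, hv1, hv2⟩ := h2 t htC
      refine ⟨v + N t, ?_⟩
      rw [← nhdsLT_sup_nhdsGT, eventually_sup]
      constructor
      · filter_upwards [hv1, hNl t] with s hs hs'
        rw [hs, hs']
      · filter_upwards [hv2, hNr t] with s hs hs'
        rw [hs, hs', hNC t htC]
        have : (1 + 1 : ZMod 2) = 0 := by decide
        linear_combination this
    · obtain ⟨v, hv⟩ := h1 t ht htC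
      refine ⟨v + N t, ?_⟩
      filter_upwards [hv, hNn t htC] with s hs hs'
      rw [hs, hs']
  choose! G hG using hG
  have hGc : ContinuousOn G (Icc a c) := fun t ht => by
    have h3 : ∀ᶠ s in 𝓝[≠] t, ∀ᶠ u in 𝓝[≠] s, w u + N u = G t := by
      have := eventually_eventually_nhdsWithin.2 (hG t ht)
      have h4 := self_mem_nhdsWithin (a := t) (s := {t}ᶜ)
      filter_upwards [this, h4] with s hs hst
      rw [(isOpen_compl_singleton (x := t)).nhdsWithin_eq hst] at hs
      exact hs.filter_mono nhdsWithin_le_nhds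
    have h5 : ∀ᶠ s in 𝓝 t, s ∈ Icc a c → G s = G t := by
      rw [eventually_nhdsWithin_iff] at h3
      filter_upwards [h3] with s hs hsI
      by_cases hst : s = t
      · rw [hst]
      · obtain ⟨u, hu1, hu2⟩ := ((hs hst).and (hG s hsI)).exists
        rw [← hu1, ← hu2]
    refine tendsto_nhds_of_eventually_eq ?_
    rwa [eventually_nhdsWithin_iff]
  have hend : ∀ t ∈ Icc a c, t ∉ C → (∀ᶠ s in 𝓝 t, w s = w t) → G t = w t + N t := by
    intro t ht htC hw
    obtain ⟨u, ⟨hu1, hu2⟩, hu3⟩ := (((hw.filter_mono nhdsWithin_le_nhds).and (hNn t htC)).and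
      (hG t ht)).exists
    rw [← hu3, hu1, hu2]
  have haI := left_mem_Icc.2 hac
  have hcI := right_mem_Icc.2 hac
  have h3 := isPreconnected_Icc.constant hGc haI hcI
  rw [hend a haI (fun h => (hCs h).1.false) ha, hend c hcI (fun h => (hCs h).2.false) hc] at h3
  have hNa : N a = 0 := by
    have : C ∩ Iio a = ∅ := by
      ext x
      simpa using fun hx => (hCs hx).1.le
    simp [hN, this]
  have hNc : N c = (C.ncard : ZMod 2) := by
    have : C ∩ Iio c = C := inter_eq_left.2 fun x hx => (hCs hx).2
    simp only [hN, this]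
  rw [hNa, hNc] at h3
  have : ((C.ncard : ZMod 2) + C.ncard) = 0 := CharTwo.add_self_eq_zero _
  linear_combination -h3 - this

/-- The winding number of a closed curve around a point, as a locally constant function on the
complement of the curve. -/
lemma IsClosedParam.exists_index {b : ℝ → ℂ} (hb : IsClosedParam b) :
    ∃ W : ℂ → ℤ, (∀ p ∉ range b, HasWinding (fun t => b t - p) (W p)) ∧
      ContinuousOn W (range b)ᶜ := by
  have hbc := hb.continuous
  have hex : ∀ p, p ∉ range b → ∃ n, HasWinding (fun t => b t - p) n := fun p hp =>
    exists_hasWinding (by fun_prop) (fun t h => hp ⟨t, sub_eq_zero.1 h⟩)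
      (fun t => by simp only [hb.add_one])
  choose! W hW using hex
  refine ⟨W, hW, fun p hp => ?_⟩
  obtain ⟨ε, hε, hball⟩ := Metric.isOpen_iff.1 hb.isCompact_range.isClosed.isOpen_compl p hp
  refine tendsto_nhds_of_eventually_eq (mem_nhdsWithin_of_mem_nhds ?_)
  filter_upwards [Metric.ball_mem_nhds p hε] with q hq
  have h1 := HasWinding.homotopy (F := fun s t => b t - (p + s * (q - p))) (n := W p)
    (by fun_prop) (fun s hs t h => hball (a := p + s * (q - p)) (by
      rw [Metric.mem_ball, dist_eq_norm] at hq ⊢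
      rw [add_sub_cancel_left, norm_mul, Complex.norm_real, Real.norm_of_nonneg hs.1]
      exact lt_of_le_of_lt (mul_le_of_le_one_left (norm_nonneg _) hs.2) hq)
      ⟨t, sub_eq_zero.1 h⟩) (fun s t => by simp only [hb.add_one])
    (by simpa using hW p hp)
  simp only [Complex.ofReal_one, one_mul, add_sub_cancel] at h1
  exact (hW q (hball hq)).unique h1

lemma index_eq_of_convex_in_chart {W : ℂ → ℤ} {s P : Set ℂ} (hW : ContinuousOn W sᶜ) {κ : ℂ → ℂ}
    (hκ : IsOpenEmbedding κ) (hP : Convex ℝ P) (hs : ∀ w ∈ P, κ w ∉ s) {x y : ℂ} (hx : x ∈ P)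
    (hy : y ∈ P) : W (κ x) = W (κ y) :=
  hP.isPreconnected.constant (f := W ∘ κ)
    (hW.comp hκ.continuous.continuousOn fun w hw => hs w hw) hx hy

lemma odd_index_sub {b : ℝ → ℂ} (hb : IsClosedParam b) {W : ℂ → ℤ}
    (hW : ∀ p ∉ range b, HasWinding (fun t => b t - p) (W p)) {κ : ℂ → ℂ}
    (hκ : IsOpenEmbedding κ) (hκb : ∀ w, κ w ∈ range b ↔ w.im = 0) :
    Odd (W (κ (-Complex.I)) - W (κ Complex.I)) := by
  let e : ℂ ≃ₜ ℂ :=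
    { toFun := fun w => w - √(1 - w.re ^ 2) * Complex.I
      invFun := fun w => w + √(1 - w.re ^ 2) * Complex.I
      left_inv := fun w => by simp
      right_inv := fun w => by simp
      continuous_toFun := by fun_prop
      continuous_invFun := by fun_prop }
  have he : ∀ w, e w = w - √(1 - w.re ^ 2) * Complex.I := fun w => rfl
  have h0 : e 0 = -Complex.I := by simp [he]
  have h2 : e (2 * Complex.I) = Complex.I := by simp [he]; ring
  refine odd_winding_sub hb (k := κ ∘ e) (hκ.comp e.isOpenEmbedding) (fun w => ?_) ?_ ?_
  · simp only [Function.comp_apply, hκb, he]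
    simp [sub_eq_zero]
  · simp only [Function.comp_apply, h0]
    exact hW _ (by simp [hκb])
  · simp only [Function.comp_apply, h2]
    exact hW _ (by simp [hκb])

theorem finite_and_even_of_charts {b r : ℝ → ℂ} (hb : IsClosedParam b) (hr : IsClosedParam r)
    {X : ℂ → Prop}
    (hX : ∀ z ∈ range b ∩ range r, X z → ∃ κ : ℂ → ℂ, IsOpenEmbedding κ ∧ κ 0 = z ∧
      (∀ w, κ w ∈ range b ↔ w.im = 0) ∧ ∀ w, κ w ∈ range r ↔ w.re = 0)
    (hT : ∀ z ∈ range b ∩ range r, ¬ X z → ∃ κ : ℂ → ℂ, IsOpenEmbedding κ ∧ κ 0 = z ∧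
      (∀ w, κ w ∈ range b ↔ w.im = 0) ∧
      ∀ w, κ w ∈ range r → 0 ≤ w.im ∧ (w.im = 0 → w = 0)) :
    (range b ∩ range r).Finite ∧ Even {z ∈ range b ∩ range r | X z}.ncard := by
  have hbcl := hb.isCompact_range.isClosed
  have hfin : (range b ∩ range r).Finite := by
    by_contra hinf
    obtain ⟨z, hz, hacc⟩ := Set.Infinite.exists_accPt_of_subset_isCompact
      (s := range b ∩ range r) hinf
      (hb.isCompact_range.inter_right hr.isCompact_range.isClosed) Subset.rfl
    obtain ⟨κ, hκ, hκz, hiso⟩ : ∃ κ : ℂ → ℂ, IsOpenEmbedding κ ∧ κ 0 = z ∧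
        ∀ w, κ w ∈ range b ∩ range r → w = 0 := by
      by_cases h : X z
      · obtain ⟨κ, hκ, hκz, h1, h2⟩ := hX z hz h
        exact ⟨κ, hκ, hκz, fun w hw => Complex.ext ((h2 w).1 hw.2) ((h1 w).1 hw.1)⟩
      · obtain ⟨κ, hκ, hκz, h1, h2⟩ := hT z hz h
        exact ⟨κ, hκ, hκz, fun w hw => (h2 w hw.2).2 ((h1 w).1 hw.1)⟩
    obtain ⟨y, ⟨⟨w, rfl⟩, hy⟩, hyz⟩ := accPt_iff_nhds.1 hacc (range κ)
      (hκ.isOpen_range.mem_nhds ⟨0, hκz⟩)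
    exact hyz (by rw [hiso w hy, hκz])
  refine ⟨hfin, ?_⟩
  obtain ⟨a, ha⟩ : ∃ a, r a ∉ range b := by
    by_contra! hall
    refine Set.infinite_range_of_injective (f := fun n : ℕ => r (1 / (n + 2))) (fun m n hmn => ?_)
      (hfin.subset ?_)
    · obtain ⟨j, hj⟩ := (hr.eq_iff _ _).1 hmn
      have h1 : ∀ n : ℕ, (0 : ℝ) < 1 / (n + 2) ∧ (1 : ℝ) / (n + 2) < 1 := fun n =>
        ⟨by positivity, by rw [div_lt_one (by positivity)]; linarith [n.cast_nonneg (α := ℝ)]⟩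
      have h2 : (j : ℝ) < 1 := by linarith [(h1 m).2, (h1 n).1]
      have h3 : (-1 : ℝ) < j := by linarith [(h1 m).1, (h1 n).2]
      have h4 : j = 0 := by
        have h2' : j < 1 := by exact_mod_cast h2
        have h3' : -1 < j := by exact_mod_cast h3
        omega
      rw [h4, Int.cast_zero, add_zero, one_div, one_div, inv_inj, add_left_inj] at hj
      exact_mod_cast hj
    · rintro _ ⟨n, rfl⟩
      exact ⟨hall _, mem_range_self _⟩
  obtain ⟨W, hW, hWc⟩ := hb.exists_index
  have hnear : ∀ t, r t ∉ range b → ∀ᶠ s in 𝓝 t, (W (r s) : ZMod 2) = W (r t) := fun t ht => by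
    have h1 : ContinuousAt (fun s => W (r s)) t :=
      (hWc.continuousAt (hbcl.isOpen_compl.mem_nhds ht)).comp hr.continuous.continuousAt
    rw [ContinuousAt, nhds_discrete ℤ, tendsto_pure] at h1
    filter_upwards [h1] with s hs
    rw [hs]
  have hinj : InjOn r (Ioo a (a + 1)) := fun s hs t ht hst => by
    obtain ⟨j, hj⟩ := (hr.eq_iff _ _).1 hst
    have h2 : (j : ℝ) < 1 := by linarith [hs.2, ht.1]
    have h3 : (-1 : ℝ) < j := by linarith [hs.1, ht.2]
    have h4 : j = 0 := by
      have h2' : j < 1 := by exact_mod_cast h2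
      have h3' : -1 < j := by exact_mod_cast h3
      omega
    rw [hj, h4, Int.cast_zero, add_zero]
  set C : Set ℝ := {t ∈ Ioo a (a + 1) | r t ∈ range b ∧ X (r t)} with hC
  have himg : r '' C = {z ∈ range b ∩ range r | X z} := by
    ext z
    constructor
    · rintro ⟨t, ht, rfl⟩
      exact ⟨⟨ht.2.1, mem_range_self _⟩, ht.2.2⟩
    · rintro ⟨⟨hzb, t, rfl⟩, hXz⟩
      have h1 : r (a + Int.fract (t - a)) = r t := by
        rw [hr.eq_iff]
        exact ⟨-⌊t - a⌋, by rw [Int.fract]; push_cast; ring⟩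
      have h2 : Int.fract (t - a) ≠ 0 := fun h => by
        rw [h, add_zero] at h1
        exact ha (h1 ▸ hzb)
      refine ⟨_, ⟨⟨?_, ?_⟩, ?_⟩, h1⟩
      · linarith [(Int.fract_nonneg (t - a)).lt_of_ne' h2]
      · linarith [Int.fract_lt_one (t - a)]
      · rw [h1]; exact ⟨hzb, hXz⟩
  have hCinj : InjOn r C := hinj.mono fun t ht => ht.1
  have hCfin : C.Finite := Set.Finite.of_finite_image
    (by rw [himg]; exact hfin.subset fun z hz => hz.1) hCinj
  have hra : r (a + 1) = r a := hr.add_one a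
  have hcard := card_eq_sub_of_jumps (w := fun t => (W (r t) : ZMod 2)) (c := a + 1)
    (by linarith) hCfin (fun t ht => ht.1) (fun t ht htC => ?_) (fun t ht => ?_)
    (hnear a ha) (hnear (a + 1) (by rwa [hra]))
  · rw [← himg, hCinj.ncard_image, ← ZMod.natCast_eq_zero_iff_even]
    simp only [hra] at hcard
    exact (left_eq_add.1 hcard)
  · by_cases htb : r t ∈ range b
    · have hta : t ∈ Ioo a (a + 1) := by
        refine ⟨ht.1.lt_of_ne ?_, ht.2.lt_of_ne ?_⟩
        · rintro rfl; exact ha htb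
        · rintro rfl; exact ha (hra ▸ htb)
      have hXt : ¬ X (r t) := fun h => htC ⟨hta, htb, h⟩
      obtain ⟨κ, hκ, hκz, h1, h2⟩ := hT _ ⟨htb, mem_range_self _⟩ hXt
      refine ⟨W (κ Complex.I), ?_⟩
      have h3 : ∀ᶠ s in 𝓝 t, r s ∈ range κ :=
        (hκ.isOpen_range.preimage hr.continuous).mem_nhds ⟨0, hκz⟩
      have h4 : ∀ᶠ s in 𝓝 t, s ∈ Ioo a (a + 1) := Ioo_mem_nhds hta.1 hta.2
      filter_upwards [mem_nhdsWithin_of_mem_nhds h3, mem_nhdsWithin_of_mem_nhds h4,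
        self_mem_nhdsWithin] with s ⟨w, hw⟩ hs4 hst
      have h5 := h2 w (hw ▸ mem_range_self s)
      have h6 : 0 < w.im := h5.1.lt_of_ne' fun h => hst (hinj hs4 hta (by
        rw [← hw, h5.2 h, hκz]))
      rw [← hw, index_eq_of_convex_in_chart hWc hκ (convex_halfSpace_im_gt 0)
        (fun w hw => by rw [h1]; exact ne_of_gt hw) h6 (by simp : Complex.I ∈ {c : ℂ | 0 < c.im})]
    · exact ⟨_, mem_nhdsWithin_of_mem_nhds (hnear t htb)⟩
  · obtain ⟨κ, hκ, hκz, h1, h2⟩ := hX _ ⟨ht.2.1, mem_range_self _⟩ ht.2.2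
    have hodd := odd_index_sub hb hW hκ h1
    have hup : ∀ y : ℝ, 0 < y → W (κ (y * Complex.I)) = W (κ Complex.I) := fun y hy =>
      index_eq_of_convex_in_chart hWc hκ (convex_halfSpace_im_gt 0)
        (fun w hw => by rw [h1]; exact ne_of_gt hw) (by simpa using hy) (by simp)
    have hdown : ∀ y : ℝ, y < 0 → W (κ (y * Complex.I)) = W (κ (-Complex.I)) := fun y hy =>
      index_eq_of_convex_in_chart hWc hκ (convex_halfSpace_im_lt 0)
        (fun w hw => by rw [h1]; exact ne_of_lt hw) (by simpa using hy) (by simp)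
    have hκc := hκ.continuous
    obtain ⟨τ₀, hτ₀, hτr₀⟩ := hr.exists_lift (fun y : ℝ => κ (y * Complex.I)) (by fun_prop)
      (fun y => by rw [h2]; simp)
    obtain ⟨j, hj⟩ := (hr.eq_iff t (τ₀ 0)).1 (by rw [hτr₀]; simp [hκz])
    obtain ⟨τ, hτ, hτr, hτ0⟩ : ∃ τ : ℝ → ℝ, Continuous τ ∧
        (∀ y : ℝ, r (τ y) = κ (y * Complex.I)) ∧ τ 0 = t :=
      ⟨fun y => τ₀ y + j, by fun_prop, fun y => by rw [hr.add_int, hτr₀], hj.symm⟩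
    have hτinj : Function.Injective τ := fun x y h => by
      have h3 := hτr x
      rw [h, hτr] at h3
      simpa using (hκ.injective h3).symm
    have hparity : (W (κ (-Complex.I)) : ZMod 2) = W (κ Complex.I) + 1 := by
      obtain ⟨i, hi⟩ := hodd
      rw [sub_eq_iff_eq_add'.1 hi]
      push_cast
      rw [show (2 : ZMod 2) = 0 from rfl]
      ring
    have hparity' : (W (κ Complex.I) : ZMod 2) = W (κ (-Complex.I)) + 1 := by
      rw [hparity, add_assoc, show (1 + 1 : ZMod 2) = 0 from rfl, add_zero]
    rcases hτ.strictMono_of_inj hτinj with hmono | hanti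
    · refine ⟨W (κ (-Complex.I)), ?_, ?_⟩
      · have h3 : τ (-1) < t := hτ0 ▸ hmono (by norm_num)
        filter_upwards [Ioo_mem_nhdsLT h3] with s hs
        obtain ⟨y, hy, rfl⟩ := intermediate_value_Ioo (by norm_num : (-1 : ℝ) ≤ 0)
          hτ.continuousOn (hτ0.symm ▸ hs)
        rw [hτr, hdown y hy.2]
      · have h3 : t < τ 1 := hτ0 ▸ hmono (by norm_num)
        filter_upwards [Ioo_mem_nhdsGT h3] with s hs
        obtain ⟨y, hy, rfl⟩ := intermediate_value_Ioo (by norm_num : (0 : ℝ) ≤ 1)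
          hτ.continuousOn (hτ0.symm ▸ hs)
        rw [hτr, hup y hy.1, hparity']
    · refine ⟨W (κ Complex.I), ?_, ?_⟩
      · have h3 : τ 1 < t := hτ0 ▸ hanti (by norm_num)
        filter_upwards [Ioo_mem_nhdsLT h3] with s hs
        obtain ⟨y, hy, rfl⟩ := intermediate_value_Ioo' (by norm_num : (0 : ℝ) ≤ 1)
          hτ.continuousOn (hτ0.symm ▸ hs)
        rw [hτr, hup y hy.1]
      · have h3 : t < τ (-1) := hτ0 ▸ hanti (by norm_num)
        filter_upwards [Ioo_mem_nhdsGT h3] with s hs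
        obtain ⟨y, hy, rfl⟩ := intermediate_value_Ioo' (by norm_num : (-1 : ℝ) ≤ 0)
          hτ.continuousOn (hτ0.symm ▸ hs)
        rw [hτr, hdown y hy.2, hparity]

lemma exists_isClosedParam {c : Set (ℝ × ℝ)} (hc : IsSimpleClosedCurve c) :
    ∃ b : ℝ → ℂ, IsClosedParam b ∧ ∀ z, z ∈ range b ↔ Complex.equivRealProdCLM z ∈ c := by
  obtain ⟨E⟩ := hc
  let e := Complex.equivRealProdCLM
  let ι := Complex.orthonormalBasisOneI.repr
  let pt : ℝ → Metric.sphere (0 : EuclideanSpace ℝ (Fin 2)) 1 := fun t =>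
    ⟨ι (Complex.exp (2 * Real.pi * Complex.I * t)), by
      rw [mem_sphere_zero_iff_norm, ι.norm_map, Complex.norm_exp]; simp⟩
  have hpt : Continuous pt := by
    refine Continuous.subtype_mk (ι.continuous.comp ?_) _
    fun_prop
  have hlift : ∀ f : ℝ → ℂ, Continuous f → (∀ x, e (f x) ∈ c) →
      ∃ τ : ℝ → ℝ, Continuous τ ∧ ∀ x, e.symm (E.symm (pt (τ x))) = f x := by
    intro f hf hfc
    let g : ℝ → ℂ := fun x => ι.symm (E ⟨e (f x), hfc x⟩)
    have hg : Continuous g := ι.symm.continuous.comp (continuous_subtype_val.comp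
      (E.continuous.comp ((e.continuous.comp hf).subtype_mk _)))
    have hnorm : ∀ x, ‖g x‖ = 1 := fun x => by
      simp only [g, ι.symm.norm_map]
      exact mem_sphere_zero_iff_norm.1 (Subtype.coe_prop _)
    obtain ⟨L, hL, hLg⟩ := exists_continuous_log hg (fun x h => by simpa [h] using hnorm x)
    refine ⟨fun x => (L x).im / (2 * Real.pi), by fun_prop, fun x => ?_⟩
    have hre : (L x).re = 0 := by
      rw [← Real.exp_eq_one_iff, ← Complex.norm_exp, hLg, hnorm]
    have hexp : Complex.exp (2 * Real.pi * Complex.I * ((L x).im / (2 * Real.pi) : ℝ)) = g x := by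
      rw [← hLg]
      congr 1
      have hpi : (Real.pi : ℂ) ≠ 0 := by exact_mod_cast Real.pi_ne_zero
      push_cast
      rw [show 2 * Real.pi * Complex.I * ((L x).im / (2 * Real.pi) : ℂ) =
        (L x).im * Complex.I by field_simp]
      apply Complex.ext <;> simp [hre]
    have hp : pt ((L x).im / (2 * Real.pi)) = E ⟨e (f x), hfc x⟩ := by
      apply Subtype.ext
      simp only [pt, hexp, g, ι.apply_symm_apply]
    rw [hp, E.symm_apply_apply, e.symm_apply_apply]
  have hrange : ∀ z, z ∈ range (fun t => e.symm (E.symm (pt t))) ↔ e z ∈ c := fun z => by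
    constructor
    · rintro ⟨t, rfl⟩
      simp
    · intro hz
      obtain ⟨τ, -, hτ⟩ := hlift (fun _ => z) continuous_const (fun _ => hz)
      exact ⟨τ 0, hτ 0⟩
  refine ⟨fun t => e.symm (E.symm (pt t)), ⟨?_, fun s t => ?_, fun f hf hfr => ?_⟩, hrange⟩
  · exact e.symm.continuous.comp (continuous_subtype_val.comp (E.symm.continuous.comp hpt))
  · rw [e.symm.injective.eq_iff, Subtype.val_injective.eq_iff, E.symm.injective.eq_iff,
      Subtype.ext_iff]
    simp only [pt]
    rw [ι.injective.eq_iff, Complex.exp_eq_exp_iff_exists_int]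
    refine exists_congr fun m => ?_
    rw [show 2 * Real.pi * Complex.I * t + m * (2 * Real.pi * Complex.I) =
      2 * Real.pi * Complex.I * ((t + m : ℝ) : ℂ) by push_cast; ring,
      mul_right_inj' Complex.two_pi_I_ne_zero, Complex.ofReal_inj]
  · exact hlift f hf fun x => (hrange _).1 (hfr x)

/-- A plane chart around a point, as an open embedding of `ℂ` in itself. -/
lemma exists_isOpenEmbedding_of_chart {U : Set (ℝ × ℝ)} (hU : IsOpen U) {z : ℝ × ℝ} (hz : z ∈ U)
    (h : U ≃ₜ ℝ × ℝ) (h0 : h ⟨z, hz⟩ = (0, 0)) :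
    ∃ κ : ℂ → ℂ, IsOpenEmbedding κ ∧ Complex.equivRealProdCLM (κ 0) = z ∧
      ∀ (c : Set (ℝ × ℝ)) (w : ℂ), Complex.equivRealProdCLM (κ w) ∈ c ↔
        (w.re, w.im) ∈ h '' {p : U | (p : ℝ × ℝ) ∈ c} := by
  let e := Complex.equivRealProdCLM.toHomeomorph
  refine ⟨fun w => e.symm (h.symm (e w)), e.symm.isOpenEmbedding.comp
    (hU.isOpenEmbedding_subtypeVal.comp (h.symm.isOpenEmbedding.comp e.isOpenEmbedding)), ?_,
    fun c w => ?_⟩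
  · have h1 : h.symm (e 0) = ⟨z, hz⟩ := by
      rw [h.symm_apply_eq, h0]
      exact map_zero Complex.equivRealProdCLM
    change e (e.symm (h.symm (e 0))) = z
    rw [h1, e.apply_symm_apply]
  · change e (e.symm (h.symm (e w))) ∈ c ↔ e w ∈ h '' {p : U | (p : ℝ × ℝ) ∈ c}
    rw [e.apply_symm_apply]
    constructor
    · exact fun hc => ⟨_, hc, h.apply_symm_apply _⟩
    · rintro ⟨p, hp, hpw⟩
      rwa [← hpw, h.symm_apply_apply]

end PlanarWinding

open PlanarWinding

/-- If every intersection point of two simple closed curves is a crossing or a tangential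
intersection, then the intersection is finite and the number of crossings is even. -/
theorem inter_finite_and_even_crossings_of_crossings_or_tangential
    (β ρ : Set (ℝ × ℝ))
    (hβ : IsSimpleClosedCurve β) (hρ : IsSimpleClosedCurve ρ)
    (h : ∀ z ∈ β ∩ ρ, IsCrossing β ρ z ∨ IsTangential β ρ z) :
    (β ∩ ρ).Finite ∧ Even {z ∈ β ∩ ρ | IsCrossing β ρ z}.ncard := by
  obtain ⟨b, hb, hbβ⟩ := exists_isClosedParam hβ
  obtain ⟨r, hr, hrρ⟩ := exists_isClosedParam hρ
  let e := Complex.equivRealProdCLM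
  have hmain := finite_and_even_of_charts hb hr (X := fun z => IsCrossing β ρ (e z)) ?_ ?_
  · have h1 : β ∩ ρ = e '' (Set.range b ∩ Set.range r) := by
      ext z
      constructor
      · intro hz
        exact ⟨e.symm z, ⟨(hbβ _).2 (by simpa [e] using hz.1),
          (hrρ _).2 (by simpa [e] using hz.2)⟩, by simp⟩
      · rintro ⟨z, hz, rfl⟩
        exact ⟨(hbβ _).1 hz.1, (hrρ _).1 hz.2⟩
    have h2 : {z ∈ β ∩ ρ | IsCrossing β ρ z} =
        e '' {z ∈ Set.range b ∩ Set.range r | IsCrossing β ρ (e z)} := by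
      rw [h1]
      ext z
      constructor
      · rintro ⟨⟨z, hz, rfl⟩, hX⟩
        exact ⟨z, ⟨hz, hX⟩, rfl⟩
      · rintro ⟨z, ⟨hz, hX⟩, rfl⟩
        exact ⟨⟨z, hz, rfl⟩, hX⟩
    rw [h2, Set.ncard_image_of_injective _ e.injective, h1]
    exact ⟨hmain.1.image _, hmain.2⟩
  · rintro z - ⟨U, hU, hz, φ, h0, h1, h2⟩
    obtain ⟨κ, hκ, hκz, hκc⟩ := exists_isOpenEmbedding_of_chart hU hz φ h0
    refine ⟨κ, hκ, e.injective hκz, fun w => ?_, fun w => ?_⟩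
    · rw [hbβ, hκc, h1]; rfl
    · rw [hrρ, hκc, h2]; rfl
  · intro z hz hX
    obtain ⟨U, hU, hzU, φ, h0, h1, h2, h3⟩ :=
      (h (e z) ⟨(hbβ _).1 hz.1, (hrρ _).1 hz.2⟩).resolve_left hX
    obtain ⟨κ, hκ, hκz, hκc⟩ := exists_isOpenEmbedding_of_chart hU hzU φ h0
    refine ⟨κ, hκ, e.injective hκz, fun w => ?_, fun w hw => ?_⟩
    · rw [hbβ, hκc, h1]; rfl
    · rw [hrρ, hκc] at hw
      refine ⟨h2 hw, fun him => ?_⟩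
      have h4 : (w.re, w.im) ∈ ({((0 : ℝ), (0 : ℝ))} : Set (ℝ × ℝ)) := h3 ▸ ⟨hw, him⟩
      exact Complex.ext (congrArg Prod.fst h4) him
end
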